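/- There exists a constant C, depending only on ξ, A, B, such that the following holds. Let f satisfy condition (f), let J ≥ 1 be an integer, and let r = f − p_J, where p_J is the J-th partial sum of the Fourier series of f. Then for every N ≥ 1: ∫_A^B ( Σ_{n=1}^N r(ξ x^{s_n}) )² dx ≤ C · N / J. -/

import Mathlib

open MeasureTheory Filter

/-- Fourier cosine coefficient of a 1-periodic function. -/
noncomputable def fourierA (f : ℝ → ℝ) (j : ℕ) : ℝ :=
  2 * ∫ x in (0:ℝ)..1, f x * Real.cos (2 * Real.pi * j * x)

/-- Fourier sine coefficient of a 1-periodic function. -/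
noncomputable def fourierB (f : ℝ → ℝ) (j : ℕ) : ℝ :=
  2 * ∫ x in (0:ℝ)..1, f x * Real.sin (2 * Real.pi * j * x)

/-- The `J`-th partial sum of the Fourier series of `f`. -/
noncomputable def fourierPartial (f : ℝ → ℝ) (J : ℕ) (x : ℝ) : ℝ :=
  ∑ j ∈ Finset.Icc 1 J,
    (fourierA f j * Real.cos (2 * Real.pi * j * x) +
     fourierB f j * Real.sin (2 * Real.pi * j * x))

/-! ### Fourier part -/

lemma four_int_cos (k : ℤ) : (∫ x in (0:ℝ)..1, Real.cos (2 * Real.pi * k * x)) =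
    if k = 0 then 1 else 0 := by
  split_ifs with h
  · subst h; simp
  · have hk : (2 * Real.pi * k) ≠ 0 := by
      have : (k:ℝ) ≠ 0 := by exact_mod_cast h
      have := Real.pi_pos.ne'
      positivity
    rw [intervalIntegral.integral_comp_mul_left (fun x => Real.cos x) hk, integral_cos]
    have : Real.sin (2 * Real.pi * k * 1) = 0 := by
      rw [show 2 * Real.pi * k * 1 = ((2 * k : ℤ) : ℝ) * Real.pi by push_cast; ring]
      exact Real.sin_int_mul_pi _
    rw [this]; simp

lemma four_int_sin (k : ℤ) : (∫ x in (0:ℝ)..1, Real.sin (2 * Real.pi * k * x)) = 0 := by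
  by_cases h : k = 0
  · subst h; simp
  · have hk : (2 * Real.pi * k) ≠ 0 := by
      have : (k:ℝ) ≠ 0 := by exact_mod_cast h
      have := Real.pi_pos.ne'
      positivity
    rw [intervalIntegral.integral_comp_mul_left (fun x => Real.sin x) hk, integral_sin]
    have : Real.cos (2 * Real.pi * k * 1) = 1 := by
      rw [show 2 * Real.pi * k * 1 = (k : ℝ) * (2 * Real.pi) by ring]
      exact Real.cos_int_mul_two_pi _
    rw [this]; simp

lemma four_cc (j n : ℕ) (hj : 1 ≤ j) : (∫ x in (0:ℝ)..1, Real.cos (2 * Real.pi * j * x) *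
    Real.cos (2 * Real.pi * n * x)) = if j = n then 1 / 2 else 0 := by
  have e : ∀ x : ℝ, Real.cos (2 * Real.pi * j * x) * Real.cos (2 * Real.pi * n * x) =
      (1/2) * (Real.cos (2 * Real.pi * ((j - n : ℤ) : ℝ) * x)) +
      (1/2) * Real.cos (2 * Real.pi * ((j + n : ℤ) : ℝ) * x) := by
    intro x
    have h1 : 2 * Real.pi * ((j - n : ℤ) : ℝ) * x =
      2 * Real.pi * j * x - 2 * Real.pi * n * x := by push_cast; ring
    have h2 : 2 * Real.pi * ((j + n : ℤ) : ℝ) * x =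
      2 * Real.pi * j * x + 2 * Real.pi * n * x := by push_cast; ring
    rw [h1, h2, Real.cos_sub, Real.cos_add]; ring
  simp_rw [e]
  rw [intervalIntegral.integral_add (Continuous.intervalIntegrable (by fun_prop) _ _)
    (Continuous.intervalIntegrable (by fun_prop) _ _), intervalIntegral.integral_const_mul,
    intervalIntegral.integral_const_mul, four_int_cos, four_int_cos]
  have h2 : ¬ ((j:ℤ) + n = 0) := by omega
  by_cases h : j = n
  · subst h; simp; omega
  · have h1 : ¬ ((j:ℤ) - n = 0) := by omega
    simp [h, h1, h2]

lemma four_ss (j n : ℕ) (hj : 1 ≤ j) : (∫ x in (0:ℝ)..1, Real.sin (2 * Real.pi * j * x) *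
    Real.sin (2 * Real.pi * n * x)) = if j = n then 1 / 2 else 0 := by
  have e : ∀ x : ℝ, Real.sin (2 * Real.pi * j * x) * Real.sin (2 * Real.pi * n * x) =
      (1/2) * (Real.cos (2 * Real.pi * ((j - n : ℤ) : ℝ) * x)) -
      (1/2) * Real.cos (2 * Real.pi * ((j + n : ℤ) : ℝ) * x) := by
    intro x
    have h1 : 2 * Real.pi * ((j - n : ℤ) : ℝ) * x =
      2 * Real.pi * j * x - 2 * Real.pi * n * x := by push_cast; ring
    have h2 : 2 * Real.pi * ((j + n : ℤ) : ℝ) * x =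
      2 * Real.pi * j * x + 2 * Real.pi * n * x := by push_cast; ring
    rw [h1, h2, Real.cos_sub, Real.cos_add]; ring
  simp_rw [e]
  rw [intervalIntegral.integral_sub (Continuous.intervalIntegrable (by fun_prop) _ _)
    (Continuous.intervalIntegrable (by fun_prop) _ _), intervalIntegral.integral_const_mul,
    intervalIntegral.integral_const_mul, four_int_cos, four_int_cos]
  have h2 : ¬ ((j:ℤ) + n = 0) := by omega
  by_cases h : j = n
  · subst h; simp; omega
  · have h1 : ¬ ((j:ℤ) - n = 0) := by omega
    simp [h, h1, h2]

lemma four_sc (j n : ℕ) : (∫ x in (0:ℝ)..1, Real.sin (2 * Real.pi * j * x) *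
    Real.cos (2 * Real.pi * n * x)) = 0 := by
  have e : ∀ x : ℝ, Real.sin (2 * Real.pi * j * x) * Real.cos (2 * Real.pi * n * x) =
      (1/2) * (Real.sin (2 * Real.pi * ((j - n : ℤ) : ℝ) * x)) +
      (1/2) * Real.sin (2 * Real.pi * ((j + n : ℤ) : ℝ) * x) := by
    intro x
    have h1 : 2 * Real.pi * ((j - n : ℤ) : ℝ) * x =
      2 * Real.pi * j * x - 2 * Real.pi * n * x := by push_cast; ring
    have h2 : 2 * Real.pi * ((j + n : ℤ) : ℝ) * x =
      2 * Real.pi * j * x + 2 * Real.pi * n * x := by push_cast; ring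
    rw [h1, h2, Real.sin_sub, Real.sin_add]; ring
  simp_rw [e]
  rw [intervalIntegral.integral_add (Continuous.intervalIntegrable (by fun_prop) _ _)
    (Continuous.intervalIntegrable (by fun_prop) _ _), intervalIntegral.integral_const_mul,
    intervalIntegral.integral_const_mul, four_int_sin, four_int_sin]
  simp

lemma fp_continuous (f : ℝ → ℝ) (J : ℕ) : Continuous (fourierPartial f J) := by
  unfold fourierPartial
  fun_prop

lemma fp_A (f : ℝ → ℝ) (J n : ℕ) : fourierA (fourierPartial f J) n =
    if 1 ≤ n ∧ n ≤ J then fourierA f n else 0 := by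
  conv_lhs => unfold fourierA fourierPartial
  simp_rw [Finset.sum_mul, add_mul, mul_assoc (fourierA f _), mul_assoc (fourierB f _)]
  rw [intervalIntegral.integral_finsetSum
    (fun i _ => Continuous.intervalIntegrable (by fun_prop) _ _)]
  have : ∀ j ∈ Finset.Icc 1 J, (∫ x in (0:ℝ)..1, (fourierA f j * (Real.cos (2 * Real.pi * j * x) *
      Real.cos (2 * Real.pi * n * x)) + fourierB f j * (Real.sin (2 * Real.pi * j * x) *
      Real.cos (2 * Real.pi * n * x)))) = if j = n then fourierA f j / 2 else 0 := by
    intro j hj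
    rw [intervalIntegral.integral_add (Continuous.intervalIntegrable (by fun_prop) _ _)
      (Continuous.intervalIntegrable (by fun_prop) _ _), intervalIntegral.integral_const_mul,
      intervalIntegral.integral_const_mul, four_sc, four_cc _ _ (Finset.mem_Icc.1 hj).1]
    split_ifs <;> ring
  rw [Finset.sum_congr rfl this, Finset.sum_ite_eq']
  simp only [Finset.mem_Icc]
  split_ifs <;> ring

lemma fp_B (f : ℝ → ℝ) (J n : ℕ) : fourierB (fourierPartial f J) n =
    if 1 ≤ n ∧ n ≤ J then fourierB f n else 0 := by
  conv_lhs => unfold fourierB fourierPartial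
  simp_rw [Finset.sum_mul, add_mul, mul_assoc (fourierA f _), mul_assoc (fourierB f _)]
  rw [intervalIntegral.integral_finsetSum
    (fun i _ => Continuous.intervalIntegrable (by fun_prop) _ _)]
  have : ∀ j ∈ Finset.Icc 1 J, (∫ x in (0:ℝ)..1, (fourierA f j * (Real.cos (2 * Real.pi * j * x) *
      Real.sin (2 * Real.pi * n * x)) + fourierB f j * (Real.sin (2 * Real.pi * j * x) *
      Real.sin (2 * Real.pi * n * x)))) = if j = n then fourierB f j / 2 else 0 := by
    intro j hj
    rw [intervalIntegral.integral_add (Continuous.intervalIntegrable (by fun_prop) _ _)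
      (Continuous.intervalIntegrable (by fun_prop) _ _), intervalIntegral.integral_const_mul,
      intervalIntegral.integral_const_mul, four_ss _ _ (Finset.mem_Icc.1 hj).1]
    simp_rw [mul_comm (Real.cos _) (Real.sin _)]
    rw [four_sc]
    split_ifs <;> ring
  rw [Finset.sum_congr rfl this, Finset.sum_ite_eq']
  simp only [Finset.mem_Icc]
  split_ifs <;> ring

lemma four_A_zero (f : ℝ → ℝ) : fourierA f 0 = 2 * ∫ x in (0:ℝ)..1, f x := by
  simp [fourierA]

lemma four_B_zero (f : ℝ → ℝ) : fourierB f 0 = 0 := by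
  simp [fourierB]

lemma fp_mean (f : ℝ → ℝ) (J : ℕ) : (∫ x in (0:ℝ)..1, fourierPartial f J x) = 0 := by
  have := fp_A f J 0
  rw [four_A_zero] at this
  simpa using this

lemma four_A_sub (f g : ℝ → ℝ) (hf : Continuous f) (hg : Continuous g) (n : ℕ) :
    fourierA (fun x => f x - g x) n = fourierA f n - fourierA g n := by
  unfold fourierA
  simp_rw [sub_mul]
  rw [intervalIntegral.integral_sub (Continuous.intervalIntegrable (by fun_prop) _ _)
      (Continuous.intervalIntegrable (by fun_prop) _ _)]
  ring

lemma four_B_sub (f g : ℝ → ℝ) (hf : Continuous f) (hg : Continuous g) (n : ℕ) :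
    fourierB (fun x => f x - g x) n = fourierB f n - fourierB g n := by
  unfold fourierB
  simp_rw [sub_mul]
  rw [intervalIntegral.integral_sub (Continuous.intervalIntegrable (by fun_prop) _ _)
      (Continuous.intervalIntegrable (by fun_prop) _ _)]
  ring

lemma four_A_deriv (h h' : ℝ → ℝ) (hd : ∀ x, HasDerivAt h (h' x) x) (hc : Continuous h')
    (hp : h 1 = h 0) (n : ℕ) : fourierA h' n = 2 * Real.pi * n * fourierB h n := by
  unfold fourierA fourierB
  have key := intervalIntegral.integral_deriv_mul_eq_sub (a := 0) (b := 1) (u := h) (u' := h')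
    (v := fun x => Real.cos (2 * Real.pi * n * x))
    (v' := fun x => -(2 * Real.pi * n) * Real.sin (2 * Real.pi * n * x))
    (fun x _ => hd x) (fun x _ => by
      have := ((hasDerivAt_id x).const_mul (2 * Real.pi * n)).cos
      simpa [mul_comm] using this) (hc.intervalIntegrable _ _)
      (Continuous.intervalIntegrable (by fun_prop) _ _)
  have hcont : Continuous h := continuous_iff_continuousAt.2 fun x => (hd x).continuousAt
  rw [intervalIntegral.integral_add (Continuous.intervalIntegrable (by fun_prop) _ _)
      (Continuous.intervalIntegrable (by fun_prop) _ _)] at key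
  have e : ∀ x, h x * (-(2 * Real.pi * n) * Real.sin (2 * Real.pi * n * x)) =
    (-(2 * Real.pi * n)) * (h x * Real.sin (2 * Real.pi * n * x)) := fun x => by ring
  simp_rw [e] at key
  rw [intervalIntegral.integral_const_mul] at key
  have c1 : Real.cos (2 * Real.pi * n * 1) = 1 := by
    rw [show 2 * Real.pi * n * 1 = (n : ℝ) * (2 * Real.pi) by ring]
    exact Real.cos_nat_mul_two_pi _
  rw [c1, hp] at key
  simp at key
  linarith

lemma four_B_deriv (h h' : ℝ → ℝ) (hd : ∀ x, HasDerivAt h (h' x) x) (hc : Continuous h')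
    (hp : h 1 = h 0) (n : ℕ) : fourierB h' n = -(2 * Real.pi * n * fourierA h n) := by
  unfold fourierA fourierB
  have key := intervalIntegral.integral_deriv_mul_eq_sub (a := 0) (b := 1) (u := h) (u' := h')
    (v := fun x => Real.sin (2 * Real.pi * n * x))
    (v' := fun x => (2 * Real.pi * n) * Real.cos (2 * Real.pi * n * x))
    (fun x _ => hd x) (fun x _ => by
      have := ((hasDerivAt_id x).const_mul (2 * Real.pi * n)).sin
      simpa [mul_comm] using this) (hc.intervalIntegrable _ _)
      (Continuous.intervalIntegrable (by fun_prop) _ _)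
  have hcont : Continuous h := continuous_iff_continuousAt.2 fun x => (hd x).continuousAt
  rw [intervalIntegral.integral_add (Continuous.intervalIntegrable (by fun_prop) _ _)
      (Continuous.intervalIntegrable (by fun_prop) _ _)] at key
  have e : ∀ x, h x * ((2 * Real.pi * n) * Real.cos (2 * Real.pi * n * x)) =
    ((2 * Real.pi * n)) * (h x * Real.cos (2 * Real.pi * n * x)) := fun x => by ring
  simp_rw [e] at key
  rw [intervalIntegral.integral_const_mul] at key
  have c1 : Real.sin (2 * Real.pi * n * 1) = 0 := by
    rw [show 2 * Real.pi * n * 1 = ((2 * n : ℕ) : ℝ) * Real.pi by push_cast; ring]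
    exact Real.sin_nat_mul_pi _
  rw [c1, hp] at key
  simp at key
  linarith

lemma four_coeff (h : ℝ → ℝ) (hc : Continuous h) (n : ℤ) (k : ℕ) (ε : ℝ) (hε : ε ^ 2 = 1)
    (hn : (n : ℝ) = ε * k) :
    ‖fourierCoeffOn (zero_lt_one' ℝ) (fun x => (h x : ℂ)) n‖ ^ 2 =
      (fourierA h k ^ 2 + fourierB h k ^ 2) / 4 := by
  have hε' : ε = 1 ∨ ε = -1 := by
    have : (ε - 1) * (ε + 1) = 0 := by linear_combination hε
    rcases mul_eq_zero.1 this with h | h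
    · left; linarith
    · right; linarith
  have e : ∀ x : ℝ, (fourier (-n) (x : AddCircle (1 - 0 : ℝ)) : ℂ) • (h x : ℂ) =
      ((h x * Real.cos (2 * Real.pi * k * x) : ℝ) : ℂ) -
        Complex.I * ((ε * (h x * Real.sin (2 * Real.pi * k * x)) : ℝ) : ℂ) := by
    intro x
    rw [fourier_coe_apply]
    have : (2 * Real.pi * Complex.I * (-n : ℤ) * x / ((1 - 0 : ℝ) : ℂ)) =
       ((-(2 * Real.pi * (ε * k) * x) : ℝ) : ℂ) * Complex.I := by
      rw [← hn]; push_cast; simp; ring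
    rw [this, Complex.exp_mul_I, ← Complex.ofReal_cos, ← Complex.ofReal_sin]
    have c : Real.cos (-(2 * Real.pi * (ε * k) * x)) = Real.cos (2 * Real.pi * k * x) := by
      rcases hε' with rfl | rfl
      · rw [Real.cos_neg]; ring_nf
      · ring_nf
    have s : Real.sin (-(2 * Real.pi * (ε * k) * x)) = -ε * Real.sin (2 * Real.pi * k * x) := by
      rcases hε' with rfl | rfl
      · rw [Real.sin_neg]; ring_nf
      · ring_nf
    rw [c, s, smul_eq_mul]
    push_cast
    ring
  rw [fourierCoeffOn_eq_integral]
  simp_rw [e]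
  rw [intervalIntegral.integral_sub (Continuous.intervalIntegrable (by fun_prop) _ _)
      (Continuous.intervalIntegrable (by fun_prop) _ _), intervalIntegral.integral_const_mul,
      intervalIntegral.integral_ofReal, intervalIntegral.integral_ofReal,
      intervalIntegral.integral_const_mul]
  unfold fourierA fourierB
  set a := ∫ x in (0:ℝ)..1, h x * Real.cos (2 * Real.pi * k * x)
  set b := ∫ x in (0:ℝ)..1, h x * Real.sin (2 * Real.pi * k * x)
  simp only [sub_zero, ne_eq, one_ne_zero, not_false_eq_true, div_self, one_smul]
  rw [← Complex.normSq_eq_norm_sq, Complex.normSq_apply]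
  simp
  rcases hε' with rfl | rfl <;> ring

lemma four_parseval (h : ℝ → ℝ) (hc : Continuous h) (h0 : (∫ x in (0:ℝ)..1, h x) = 0) :
    HasSum (fun n : ℕ => (fourierA h n ^ 2 + fourierB h n ^ 2) / 2) (∫ x in (0:ℝ)..1, h x ^ 2) := by
  have hm : MemLp (fun x => (h x : ℂ)) 2 (volume.restrict (Set.Ioc (0:ℝ) 1)) := by
    have hcc : Continuous (fun x => (h x : ℂ)) := by fun_prop
    obtain ⟨C, hC⟩ := (isCompact_Icc (a := (0:ℝ)) (b := 1)).exists_bound_of_continuousOn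
      hcc.continuousOn
    refine MemLp.of_bound hcc.aestronglyMeasurable C ?_
    refine (ae_restrict_iff' measurableSet_Ioc).2 (Eventually.of_forall fun x hx => hC x ⟨hx.1.le, hx.2⟩)
  have := (hasSum_sq_fourierCoeffOn (zero_lt_one' ℝ) hm).nat_add_neg
  have hz : ‖fourierCoeffOn (zero_lt_one' ℝ) (fun x => (h x : ℂ)) 0‖ ^ 2 = 0 := by
    rw [four_coeff h hc 0 0 1 (by norm_num) (by norm_num), four_A_zero, four_B_zero, h0]
    norm_num
  rw [hz] at this
  have e2 : (1 - 0 : ℝ)⁻¹ • (∫ x in (0:ℝ)..1, ‖(h x : ℂ)‖ ^ 2) + 0 =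
      ∫ x in (0:ℝ)..1, h x ^ 2 := by
    simp
  rw [e2] at this
  convert this using 2 with n
  rw [four_coeff h hc n n 1 (by norm_num) (by push_cast; ring),
    four_coeff h hc (-n) n (-1) (by norm_num) (by push_cast; ring)]
  ring

lemma four_tail (h : ℝ → ℝ) (hc : Continuous h) (h0 : (∫ x in (0:ℝ)..1, h x) = 0) (J : ℕ)
    (hJ : 1 ≤ J) (K : ℝ) (hK : 0 ≤ K)
    (hlow : ∀ n, n ≤ J → fourierA h n = 0 ∧ fourierB h n = 0)
    (hhigh : ∀ n : ℕ, J < n → fourierA h n ^ 2 + fourierB h n ^ 2 ≤ 2 * K * ((n:ℝ) ^ 2)⁻¹) :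
    (∫ x in (0:ℝ)..1, h x ^ 2) ≤ K / J := by
  have hs := (four_parseval h hc h0).tendsto_sum_nat
  refine le_of_tendsto' hs fun M => ?_
  calc ∑ i ∈ Finset.range M, (fourierA h i ^ 2 + fourierB h i ^ 2) / 2
      ≤ ∑ i ∈ Finset.range (J + M + 1), (fourierA h i ^ 2 + fourierB h i ^ 2) / 2 := by
        apply Finset.sum_le_sum_of_subset_of_nonneg
        · intro i hi; simp at hi ⊢; omega
        · intros; positivity
    _ = ∑ i ∈ Finset.Ioc J (J + M), (fourierA h i ^ 2 + fourierB h i ^ 2) / 2 := by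
        symm
        apply Finset.sum_subset
        · intro i hi; simp at hi ⊢; omega
        · intro i hi hi'
          have : i ≤ J := by simp at hi hi'; omega
          rw [(hlow i this).1, (hlow i this).2]; norm_num
    _ ≤ ∑ i ∈ Finset.Ioc J (J + M), K * ((i:ℝ) ^ 2)⁻¹ := by
        apply Finset.sum_le_sum
        intro i hi
        have := hhigh i (Finset.mem_Ioc.1 hi).1
        linarith
    _ = K * ∑ i ∈ Finset.Ioc J (J + M), ((i:ℝ) ^ 2)⁻¹ := by rw [Finset.mul_sum]
    _ ≤ K * ((J:ℝ)⁻¹ - ((J + M : ℕ) : ℝ)⁻¹) := by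
        gcongr
        exact sum_Ioc_inv_sq_le_sub (by omega) (by omega)
    _ ≤ K * (J:ℝ)⁻¹ := by
        gcongr
        have : 0 ≤ ((J + M : ℕ) : ℝ)⁻¹ := by positivity
        linarith
    _ = K / J := by ring

lemma four_low (h : ℝ → ℝ) (hc : Continuous h) (h0 : (∫ x in (0:ℝ)..1, h x) = 0) (J : ℕ)
    (K : ℝ)
    (hlow : ∀ n, J < n → fourierA h n = 0 ∧ fourierB h n = 0)
    (hhigh : ∀ n : ℕ, n ≤ J → fourierA h n ^ 2 + fourierB h n ^ 2 ≤ 2 * K) :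
    (∫ x in (0:ℝ)..1, h x ^ 2) ≤ K * J := by
  have hs := four_parseval h hc h0
  have h2 : HasSum (fun n : ℕ => (fourierA h n ^ 2 + fourierB h n ^ 2) / 2)
      (∑ n ∈ Finset.Icc 1 J, (fourierA h n ^ 2 + fourierB h n ^ 2) / 2) := by
    apply hasSum_sum_of_ne_finset_zero
    intro b hb
    rcases Nat.eq_zero_or_pos b with rfl | hb'
    · rw [four_A_zero, four_B_zero, h0]; norm_num
    · have : J < b := by simp at hb; omega
      rw [(hlow b this).1, (hlow b this).2]; norm_num
  rw [hs.unique h2]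
  calc _ ≤ ∑ n ∈ Finset.Icc 1 J, K := by
        apply Finset.sum_le_sum
        intro i hi
        have := hhigh i (Finset.mem_Icc.1 hi).2
        linarith
    _ = K * J := by simp; ring

lemma four_abs_A (h : ℝ → ℝ) (hc : Continuous h) (n : ℕ) :
    |fourierA h n| ≤ 2 * ∫ x in (0:ℝ)..1, |h x| := by
  unfold fourierA
  rw [abs_mul, abs_two]
  gcongr
  refine (intervalIntegral.abs_integral_le_integral_abs zero_le_one).trans ?_
  apply intervalIntegral.integral_mono_on zero_le_one
    (Continuous.intervalIntegrable (by fun_prop) _ _) (Continuous.intervalIntegrable (by fun_prop) _ _)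
  intro x _
  rw [abs_mul]
  exact mul_le_of_le_one_right (abs_nonneg _) (Real.abs_cos_le_one _)

lemma four_abs_B (h : ℝ → ℝ) (hc : Continuous h) (n : ℕ) :
    |fourierB h n| ≤ 2 * ∫ x in (0:ℝ)..1, |h x| := by
  unfold fourierB
  rw [abs_mul, abs_two]
  gcongr
  refine (intervalIntegral.abs_integral_le_integral_abs zero_le_one).trans ?_
  apply intervalIntegral.integral_mono_on zero_le_one
    (Continuous.intervalIntegrable (by fun_prop) _ _) (Continuous.intervalIntegrable (by fun_prop) _ _)
  intro x _
  rw [abs_mul]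
  exact mul_le_of_le_one_right (abs_nonneg _) (Real.abs_sin_le_one _)

/-! ### Estimates for the remainder -/

lemma per_cos (j : ℕ) (x : ℝ) : Real.cos (2 * Real.pi * j * (x + 1)) =
    Real.cos (2 * Real.pi * j * x) := by
  rw [show 2 * Real.pi * j * (x + 1) = 2 * Real.pi * j * x + (j : ℝ) * (2 * Real.pi) by ring]
  exact Real.cos_add_nat_mul_two_pi _ _

lemma per_sin (j : ℕ) (x : ℝ) : Real.sin (2 * Real.pi * j * (x + 1)) =
    Real.sin (2 * Real.pi * j * x) := by
  rw [show 2 * Real.pi * j * (x + 1) = 2 * Real.pi * j * x + (j : ℝ) * (2 * Real.pi) by ring]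
  exact Real.sin_add_nat_mul_two_pi _ _

lemma fp_per (f : ℝ → ℝ) (J : ℕ) (x : ℝ) : fourierPartial f J (x + 1) = fourierPartial f J x := by
  unfold fourierPartial
  simp_rw [per_cos, per_sin]

noncomputable def fpd (f : ℝ → ℝ) (J : ℕ) (x : ℝ) : ℝ :=
  ∑ j ∈ Finset.Icc 1 J,
    (fourierA f j * (-(2 * Real.pi * j) * Real.sin (2 * Real.pi * j * x)) +
     fourierB f j * ((2 * Real.pi * j) * Real.cos (2 * Real.pi * j * x)))

lemma fpd_continuous (f : ℝ → ℝ) (J : ℕ) : Continuous (fpd f J) := by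
  unfold fpd
  fun_prop

lemma fpd_per (f : ℝ → ℝ) (J : ℕ) (x : ℝ) : fpd f J (x + 1) = fpd f J x := by
  unfold fpd
  simp_rw [per_cos, per_sin]

lemma fpd_deriv (f : ℝ → ℝ) (J : ℕ) (x : ℝ) : HasDerivAt (fourierPartial f J) (fpd f J x) x := by
  unfold fpd
  have : fourierPartial f J = fun x => ∑ j ∈ Finset.Icc 1 J,
    (fourierA f j * Real.cos (2 * Real.pi * j * x) +
     fourierB f j * Real.sin (2 * Real.pi * j * x)) := rfl
  rw [this]
  refine HasDerivAt.fun_sum fun j _ => ?_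
  have h1 : HasDerivAt (fun x => Real.cos (2 * Real.pi * j * x))
      (-(2 * Real.pi * j) * Real.sin (2 * Real.pi * j * x)) x := by
    have := ((hasDerivAt_id x).const_mul (2 * Real.pi * j)).cos
    simpa [mul_comm] using this
  have h2 : HasDerivAt (fun x => Real.sin (2 * Real.pi * j * x))
      ((2 * Real.pi * j) * Real.cos (2 * Real.pi * j * x)) x := by
    have := ((hasDerivAt_id x).const_mul (2 * Real.pi * j)).sin
    simpa [mul_comm] using this
  exact (h1.const_mul _).add (h2.const_mul _)

lemma sq_bound_of_abs {u c : ℝ} (h : |u| ≤ c) : u ^ 2 ≤ c ^ 2 :=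
  sq_le_sq' (abs_le.1 h).1 (abs_le.1 h).2

lemma sup_of_L2 (R r : ℝ → ℝ) (hd : ∀ x, HasDerivAt R (r x) x) (hr : Continuous r)
    (hp : ∀ x, R (x + 1) = R x) (J : ℝ) (hJ : 1 ≤ J)
    (h1 : (∫ x in (0:ℝ)..1, r x ^ 2) ≤ 4 / J) (h2 : (∫ x in (0:ℝ)..1, R x ^ 2) ≤ 1 / J ^ 3) (x : ℝ) :
    |R x| ≤ 3 / J := by
  have hR : Continuous R := continuous_iff_continuousAt.2 fun x => (hd x).continuousAt
  have hJ0 : 0 < J := by linarith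
  have hmain : (∫ t in (0:ℝ)..1, |2 * R t * r t|) ≤ 5 / J ^ 2 := by
    calc (∫ t in (0:ℝ)..1, |2 * R t * r t|) ≤ ∫ t in (0:ℝ)..1, (J * R t ^ 2 + J⁻¹ * r t ^ 2) := by
          apply intervalIntegral.integral_mono_on zero_le_one
            (Continuous.intervalIntegrable (by fun_prop) _ _)
            (Continuous.intervalIntegrable (by fun_prop) _ _)
          intro t _
          have e : J * R t ^ 2 + J⁻¹ * r t ^ 2 = J⁻¹ * ((J * R t) ^ 2 + r t ^ 2) := by
            field_simp
          have e2 : 2 * R t * r t = J⁻¹ * (2 * (J * R t) * r t) := by field_simp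
          rw [e, e2, abs_mul, abs_of_pos (inv_pos.2 hJ0)]
          gcongr
          rw [abs_le]
          constructor <;> nlinarith [sq_nonneg (J * R t - r t), sq_nonneg (J * R t + r t)]
      _ = J * (∫ t in (0:ℝ)..1, R t ^ 2) + J⁻¹ * ∫ t in (0:ℝ)..1, r t ^ 2 := by
          rw [intervalIntegral.integral_add (Continuous.intervalIntegrable (by fun_prop) _ _)
            (Continuous.intervalIntegrable (by fun_prop) _ _),
            intervalIntegral.integral_const_mul, intervalIntegral.integral_const_mul]
      _ ≤ J * (1 / J ^ 3) + J⁻¹ * (4 / J) := by gcongr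
      _ = 5 / J ^ 2 := by field_simp; norm_num
  obtain ⟨y, hy, hxy⟩ := (show Function.Periodic R 1 from hp).exists_mem_Ico₀ one_pos x
  rw [hxy]
  have hk : ∀ z ∈ Set.Icc (0:ℝ) 1, R y ^ 2 - 5 / J ^ 2 ≤ R z ^ 2 := by
    intro z hz
    have hf : (∫ t in z..y, 2 * R t * r t) = R y ^ 2 - R z ^ 2 := by
      apply intervalIntegral.integral_eq_sub_of_hasDerivAt
      · intro t _
        have := (hd t).fun_pow 2
        simpa using this
      · exact Continuous.intervalIntegrable (by fun_prop) _ _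
    have hle : |∫ t in z..y, 2 * R t * r t| ≤ ∫ t in (0:ℝ)..1, |2 * R t * r t| := by
      refine (intervalIntegral.norm_integral_le_integral_norm_uIoc (f := fun t => 2 * R t * r t)).trans ?_
      rw [intervalIntegral.integral_of_le zero_le_one]
      apply setIntegral_mono_set
      · exact (Continuous.integrableOn_Ioc (by fun_prop))
      · exact Eventually.of_forall fun t => abs_nonneg _
      · apply LE.le.eventuallyLE
        intro t ht
        rw [Set.mem_uIoc] at ht
        rcases ht with ht | ht
        · exact ⟨lt_of_le_of_lt hz.1 ht.1, ht.2.trans hy.2.le⟩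
        · exact ⟨lt_of_le_of_lt hy.1 ht.1, ht.2.trans hz.2⟩
    rw [hf] at hle
    have := (abs_le.1 (hle.trans hmain)).2
    linarith
  have hint : (∫ z in (0:ℝ)..1, (R y ^ 2 - 5 / J ^ 2)) ≤ ∫ z in (0:ℝ)..1, R z ^ 2 := by
    apply intervalIntegral.integral_mono_on zero_le_one
      (Continuous.intervalIntegrable (by fun_prop) _ _)
      (Continuous.intervalIntegrable (by fun_prop) _ _)
    exact hk
  simp only [intervalIntegral.integral_const, sub_zero, one_smul] at hint
  have h3 : 1 / J ^ 3 ≤ 1 / J ^ 2 := by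
    apply one_div_le_one_div_of_le (by positivity)
    exact pow_le_pow_right₀ hJ (by norm_num)
  apply abs_le_of_sq_le_sq _ (by positivity)
  have : (3 / J) ^ 2 = 9 * (1 / J ^ 2) := by field_simp; norm_num
  have h5 : 5 / J ^ 2 = 5 * (1 / J ^ 2) := by field_simp
  have : 0 < 1 / J ^ 2 := by positivity
  linarith

lemma remainder (f f' : ℝ → ℝ) (hd : ∀ x, HasDerivAt f (f' x) x) (hc : Continuous f')
    (hp : ∀ x, f (x + 1) = f x) (h0 : (∫ x in (0:ℝ)..1, f x) = 0)
    (hV : (∫ x in (0:ℝ)..1, |f' x|) ≤ 6) (J : ℕ) (hJ : 1 ≤ J) :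
    ∃ R : ℝ → ℝ, (∀ x, HasDerivAt R (f x - fourierPartial f J x) x) ∧ (∀ x, R (x + 1) = R x) ∧
      (∫ x in (0:ℝ)..1, (f x - fourierPartial f J x) ^ 2) ≤ 4 / J ∧
      (∫ x in (0:ℝ)..1, R x ^ 2) ≤ 1 / (J:ℝ) ^ 3 ∧
      (∫ x in (0:ℝ)..1, fpd f J x ^ 2) ≤ 144 * J ∧
      ∀ x, |R x| ≤ 3 / J := by
  have hf : Continuous f := continuous_iff_continuousAt.2 fun x => (hd x).continuousAt
  have hpc := fp_continuous f J
  set r : ℝ → ℝ := fun x => f x - fourierPartial f J x with hr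
  have hrc : Continuous r := by fun_prop
  have hr0 : (∫ x in (0:ℝ)..1, r x) = 0 := by
    rw [hr, intervalIntegral.integral_sub (hf.intervalIntegrable _ _) (hpc.intervalIntegrable _ _),
      h0, fp_mean, sub_zero]
  have hrp : ∀ x, r (x + 1) = r x := fun x => by simp [hr, hp, fp_per]
  have hJ' : (1:ℝ) ≤ J := by exact_mod_cast hJ
  have hf10 : f 1 = f 0 := by simpa using hp 0
  -- coefficients of f
  have hfA : ∀ n : ℕ, |2 * Real.pi * n * fourierA f n| ≤ 12 := by
    intro n
    have := four_abs_B f' hc n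
    rw [four_B_deriv f f' hd hc hf10, abs_neg] at this
    linarith
  have hfB : ∀ n : ℕ, |2 * Real.pi * n * fourierB f n| ≤ 12 := by
    intro n
    have := four_abs_A f' hc n
    rw [four_A_deriv f f' hd hc hf10] at this
    linarith
  have hpi : 9 ≤ Real.pi ^ 2 := by nlinarith [Real.pi_gt_three]
  have hfAB : ∀ n : ℕ, 1 ≤ n → fourierA f n ^ 2 + fourierB f n ^ 2 ≤ 2 * 4 * ((n:ℝ) ^ 2)⁻¹ := by
    intro n hn
    have hn' : (0:ℝ) < n := by exact_mod_cast hn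
    have a1 := sq_bound_of_abs (hfA n)
    have b1 := sq_bound_of_abs (hfB n)
    rw [← div_eq_mul_inv, le_div_iff₀ (by positivity)]
    have q : 0 ≤ (fourierA f n ^ 2 + fourierB f n ^ 2) * n ^ 2 := by positivity
    nlinarith [mul_le_mul_of_nonneg_right hpi q]
  have hrA : ∀ n : ℕ, fourierA r n = if n ≤ J then 0 else fourierA f n := by
    intro n
    rcases Nat.eq_zero_or_pos n with rfl | hn
    · rw [four_A_zero, hr0]; simp
    · rw [hr, four_A_sub f _ hf hpc, fp_A]
      have hn1 : 1 ≤ n := hn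
      by_cases h : n ≤ J <;> simp [h, hn1]
  have hrB : ∀ n : ℕ, fourierB r n = if n ≤ J then 0 else fourierB f n := by
    intro n
    rcases Nat.eq_zero_or_pos n with rfl | hn
    · rw [four_B_zero]; simp
    · rw [hr, four_B_sub f _ hf hpc, fp_B]
      have hn1 : 1 ≤ n := hn
      by_cases h : n ≤ J <;> simp [h, hn1]
  have hrAB : ∀ n : ℕ, J < n → fourierA r n ^ 2 + fourierB r n ^ 2 ≤ 2 * 4 * ((n:ℝ) ^ 2)⁻¹ := by
    intro n hn
    rw [hrA, hrB, if_neg (by omega), if_neg (by omega)]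
    exact hfAB n (by omega)
  have hr2 : (∫ x in (0:ℝ)..1, r x ^ 2) ≤ 4 / J := by
    apply four_tail r hrc hr0 J hJ 4 (by norm_num) _ hrAB
    intro n hn
    rw [hrA, hrB, if_pos hn, if_pos hn]; simp
  -- the primitive
  set F : ℝ → ℝ := fun x => ∫ t in (0:ℝ)..x, r t with hF
  have hFd : ∀ x, HasDerivAt F (r x) x := fun x =>
    intervalIntegral.integral_hasDerivAt_right (hrc.intervalIntegrable _ _)
      (hrc.stronglyMeasurableAtFilter _ _) hrc.continuousAt
  have hFc : Continuous F := continuous_iff_continuousAt.2 fun x => (hFd x).continuousAt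
  have hFp : ∀ x, F (x + 1) = F x := by
    intro x
    have h1 : F (x + 1) = F x + ∫ t in x..(x+1), r t := by
      rw [hF]; simp only
      rw [intervalIntegral.integral_add_adjacent_intervals (hrc.intervalIntegrable _ _)
        (hrc.intervalIntegrable _ _)]
    have h2 := (show Function.Periodic r 1 from hrp).intervalIntegral_add_eq x 0
    rw [h1, h2, zero_add, hr0, add_zero]
  set m : ℝ := ∫ x in (0:ℝ)..1, F x
  set R : ℝ → ℝ := fun x => F x - m with hRdef
  have hRd : ∀ x, HasDerivAt R (r x) x := fun x => (hFd x).sub_const m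
  have hRp : ∀ x, R (x + 1) = R x := fun x => by simp [hRdef, hFp]
  have hRc : Continuous R := by fun_prop
  have hR0 : (∫ x in (0:ℝ)..1, R x) = 0 := by
    rw [hRdef, intervalIntegral.integral_sub (hFc.intervalIntegrable _ _) (by simp)]
    simp [m]
  have hR10 : R 1 = R 0 := by simpa using hRp 0
  have hRA := four_A_deriv R r hRd hrc hR10
  have hRB := four_B_deriv R r hRd hrc hR10
  have hR2 : (∫ x in (0:ℝ)..1, R x ^ 2) ≤ 1 / (J:ℝ) ^ 3 := by
    have : (1:ℝ) / (J:ℝ) ^ 3 = (1 / (J:ℝ)^2) / J := by field_simp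
    rw [this]
    apply four_tail R hRc hR0 J hJ _ (by positivity)
    · intro n hn
      rcases Nat.eq_zero_or_pos n with rfl | hn0
      · rw [four_A_zero, hR0, four_B_zero]; simp
      · have hn' : (0:ℝ) < n := by exact_mod_cast hn0
        have a := hRA n
        have b := hRB n
        rw [hrA, if_pos hn] at a
        rw [hrB, if_pos hn] at b
        have h2 : 2 * Real.pi * n ≠ 0 := by positivity
        constructor
        · have := neg_eq_zero.1 b.symm
          exact (mul_eq_zero.1 this).resolve_left h2
        · exact (mul_eq_zero.1 a.symm).resolve_left h2
    · intro n hn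
      have hn' : (J:ℝ) ≤ n := by exact_mod_cast hn.le
      have hn0 : (0:ℝ) < n := by linarith
      have := hrAB n hn
      rw [hRA, hRB] at this
      have hq : (fourierA R n ^ 2 + fourierB R n ^ 2) ≤ 2 * ((n:ℝ)^2)⁻¹ * ((n:ℝ)^2)⁻¹ := by
        set q := fourierA R n ^ 2 + fourierB R n ^ 2 with hqd
        have e : (2 * Real.pi * n * fourierB R n) ^ 2 + (-(2 * Real.pi * n * fourierA R n)) ^ 2 =
          4 * Real.pi ^ 2 * (q * n ^ 2) := by rw [hqd]; ring
        rw [e] at this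
        rw [← div_eq_mul_inv, le_div_iff₀ (by positivity)]
        have q0 : 0 ≤ q * n ^ 2 := by positivity
        have i0 : 0 ≤ ((n:ℝ)^2)⁻¹ := by positivity
        nlinarith [mul_le_mul_of_nonneg_right hpi q0]
      refine hq.trans ?_
      rw [one_div]
      gcongr
  refine ⟨R, hRd, hRp, hr2, hR2, ?_, sup_of_L2 R r hRd hrc hRp J hJ' hr2 hR2⟩
  have hp10 : fourierPartial f J 1 = fourierPartial f J 0 := by simpa using fp_per f J 0
  have hdA := four_A_deriv _ _ (fpd_deriv f J) (fpd_continuous f J) hp10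
  have hdB := four_B_deriv _ _ (fpd_deriv f J) (fpd_continuous f J) hp10
  apply four_low _ (fpd_continuous f J) _ J 144
  · intro n hn
    rw [hdA, hdB, fp_A, fp_B, if_neg (by omega), if_neg (by omega)]; simp
  · intro n hn
    rw [hdA, hdB, fp_A, fp_B]
    split_ifs
    · have a1 := sq_bound_of_abs (hfA n)
      have b1 := sq_bound_of_abs (hfB n)
      rw [neg_sq]
      linarith
    · simp
  · rw [intervalIntegral.integral_eq_sub_of_hasDerivAt (fun x _ => fpd_deriv f J x)
      ((fpd_continuous f J).intervalIntegrable _ _), hp10, sub_self]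

/-! ### Oscillatory estimates -/

lemma inv_pow_deriv (k : ℕ) (x : ℝ) (hx : 0 < x) :
    HasDerivAt (fun x : ℝ => (x ^ k)⁻¹) (-(k * (x ^ (k + 1))⁻¹)) x := by
  have := (hasDerivAt_pow k x).fun_inv (by positivity)
  refine this.congr_deriv ?_
  rcases k with _ | k
  · simp
  · simp only [Nat.add_sub_cancel]
    field_simp
    ring

lemma mono_deriv (ξ : ℝ) (k : ℕ) (x : ℝ) :
    HasDerivAt (fun x : ℝ => ξ * x ^ (k + 1)) (ξ * ((k + 1 : ℕ) * x ^ k)) x := by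
  simpa using (hasDerivAt_pow (k + 1) x).const_mul ξ

lemma comp_bound (ξ a b : ℝ) (hξ : 0 < ξ) (ha : 1 < a) (hab : a < b) (h : ℝ → ℝ)
    (hc : Continuous h) (hn : ∀ x, 0 ≤ h x) (hp : ∀ x, h (x + 1) = h x) (m : ℕ) (hm : 1 ≤ m) :
    (∫ x in a..b, h (ξ * x ^ m)) ≤ ((b - a) + 2 / ξ) * ∫ x in (0:ℝ)..1, h x := by
  obtain ⟨k, rfl⟩ : ∃ k, m = k + 1 := ⟨m - 1, by omega⟩
  set M := ∫ x in (0:ℝ)..1, h x with hM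
  have hM0 : 0 ≤ M := intervalIntegral.integral_nonneg zero_le_one fun x _ => hn x
  set E : ℝ → ℝ := fun y => (∫ t in (0:ℝ)..y, h t) - M * y with hE
  have hEd : ∀ y, HasDerivAt E (h y - M) y := by
    intro y
    have h1 : HasDerivAt (fun y => ∫ t in (0:ℝ)..y, h t) (h y) y :=
      intervalIntegral.integral_hasDerivAt_right (hc.intervalIntegrable _ _)
        (hc.stronglyMeasurableAtFilter _ _) hc.continuousAt
    have h2 : HasDerivAt (fun y : ℝ => M * y) M y := by
      simpa using (hasDerivAt_id y).const_mul M
    exact h1.sub h2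
  have hEc : Continuous E := continuous_iff_continuousAt.2 fun x => (hEd x).continuousAt
  have hEp : Function.Periodic E 1 := by
    intro x
    have h1 : (∫ t in (0:ℝ)..(x+1), h t) = (∫ t in (0:ℝ)..x, h t) + ∫ t in x..(x+1), h t := by
      rw [intervalIntegral.integral_add_adjacent_intervals (hc.intervalIntegrable _ _)
        (hc.intervalIntegrable _ _)]
    have h2 := (show Function.Periodic h 1 from hp).intervalIntegral_add_eq x 0
    rw [zero_add, ← hM] at h2
    simp only [hE]
    rw [h1, h2]; ring
  have hEb : ∀ y, |E y| ≤ M := by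
    intro y
    obtain ⟨z, hz, hyz⟩ := hEp.exists_mem_Ico₀ one_pos y
    rw [hyz]
    have i1 : 0 ≤ ∫ t in (0:ℝ)..z, h t := intervalIntegral.integral_nonneg hz.1 fun x _ => hn x
    have i2 : 0 ≤ ∫ t in z..1, h t := intervalIntegral.integral_nonneg hz.2.le fun x _ => hn x
    have i3 : (∫ t in (0:ℝ)..z, h t) + (∫ t in z..1, h t) = M :=
      intervalIntegral.integral_add_adjacent_intervals (hc.intervalIntegrable _ _)
        (hc.intervalIntegrable _ _)
    have i4 : M * z ≤ M := by nlinarith [hz.2]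
    have i5 : 0 ≤ M * z := mul_nonneg hM0 hz.1
    rw [abs_le]
    constructor <;> simp only [hE] <;> linarith
  have hpos : ∀ x ∈ Set.uIcc a b, 0 < x := by
    intro x hx
    rw [Set.uIcc_of_le hab.le] at hx
    linarith [hx.1]
  set c : ℝ := (ξ * (k + 1 : ℕ))⁻¹ with hcdef
  have hc0 : 0 < c := by positivity
  set G : ℝ → ℝ := fun x => c * (x ^ k)⁻¹ with hG
  set G' : ℝ → ℝ := fun x => c * (-(k * (x ^ (k + 1))⁻¹)) with hG'
  have hGd : ∀ x, 0 < x → HasDerivAt G (G' x) x := fun x hx => (inv_pow_deriv k x hx).const_mul c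
  have hG'c : ContinuousOn G' (Set.uIcc a b) := by
    apply ContinuousOn.mul continuousOn_const
    apply ContinuousOn.neg
    apply ContinuousOn.mul continuousOn_const
    apply ContinuousOn.inv₀ (by fun_prop)
    intro x hx
    have := hpos x hx
    positivity
  have hP : ∀ x ∈ Set.uIcc a b, HasDerivAt (fun x => E (ξ * x ^ (k + 1)) * G x)
      ((h (ξ * x ^ (k + 1)) - M) + E (ξ * x ^ (k + 1)) * G' x) x := by
    intro x hx
    have hx0 := hpos x hx
    have := ((hEd (ξ * x ^ (k + 1))).comp x (mono_deriv ξ k x)).mul (hGd x hx0)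
    refine this.congr_deriv ?_
    simp only [hG, hcdef, Function.comp]
    field_simp
  have hi1 : IntervalIntegrable (fun x => h (ξ * x ^ (k + 1)) - M) volume a b :=
    Continuous.intervalIntegrable (by fun_prop) _ _
  have hi2 : IntervalIntegrable (fun x => E (ξ * x ^ (k + 1)) * G' x) volume a b :=
    ContinuousOn.intervalIntegrable (ContinuousOn.mul (by fun_prop) hG'c)
  have key := intervalIntegral.integral_eq_sub_of_hasDerivAt hP (hi1.add hi2)
  rw [intervalIntegral.integral_add hi1 hi2, intervalIntegral.integral_sub
    (Continuous.intervalIntegrable (by fun_prop) _ _) (by simp)] at key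
  simp only [intervalIntegral.integral_const, smul_eq_mul] at key
  have hGi : (∫ x in a..b, G' x) = G b - G a :=
    intervalIntegral.integral_eq_sub_of_hasDerivAt (fun x hx => hGd x (hpos x hx))
      hG'c.intervalIntegrable
  have hlow : (∫ x in a..b, M * G' x) ≤ ∫ x in a..b, E (ξ * x ^ (k + 1)) * G' x := by
    apply intervalIntegral.integral_mono_on hab.le (hG'c.intervalIntegrable.const_mul M) hi2
    intro x hx
    have hx0 : 0 < x := by linarith [hx.1]
    have hneg : G' x ≤ 0 := by
      have : 0 ≤ c * (k * (x ^ (k + 1))⁻¹) := by positivity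
      simp only [hG']; linarith
    exact mul_le_mul_of_nonpos_right (abs_le.1 (hEb _)).2 hneg
  rw [intervalIntegral.integral_const_mul, hGi] at hlow
  have hGpos : ∀ x, 0 < x → 0 < G x := fun x hx => by simp only [hG]; positivity
  have hGa := hGpos a (by linarith)
  have hGb := hGpos b (by linarith)
  have b1 : E (ξ * b ^ (k + 1)) * G b ≤ M * G b :=
    mul_le_mul_of_nonneg_right (abs_le.1 (hEb _)).2 hGb.le
  have b2 : -M * G a ≤ E (ξ * a ^ (k + 1)) * G a :=
    mul_le_mul_of_nonneg_right (abs_le.1 (hEb _)).1 hGa.le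
  have b3 : G a ≤ 1 / ξ := by
    simp only [hG, hcdef]
    rw [← mul_inv, one_div]
    apply inv_anti₀ hξ
    have h1 : (1:ℝ) ≤ (k + 1 : ℕ) := Nat.one_le_cast.2 (by omega)
    have h2 : (1:ℝ) ≤ a ^ k := one_le_pow₀ ha.le
    calc ξ = ξ * 1 * 1 := by ring
      _ ≤ ξ * (k + 1 : ℕ) * a ^ k := by gcongr
  have b4 : M * G a ≤ M * (1 / ξ) := mul_le_mul_of_nonneg_left b3 hM0
  have e : ((b - a) + 2 / ξ) * M = (b - a) * M + 2 * (M * (1 / ξ)) := by ring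
  rw [e]
  linarith

lemma pw_alg (g1 g2 rp up vp Rq J ρ K1 L : ℝ) (hJ0 : 0 < J) (hρ0 : 0 < ρ) (hK10 : 0 < K1)
    (t1 : |g1| ≤ ρ * K1) (t2 : |g2| ≤ ρ * L ^ 2) (hRq3 : |Rq| ≤ 3 / J) :
    |g1 * (rp * Rq) + g2 * ((up - vp) * Rq)| ≤ ρ * ((K1 / 2) * rp ^ 2 +
      ((K1 / 2 + L ^ 2 / 2 * J ^ 2) * Rq ^ 2 +
      (L ^ 2 * (3 / J) * |up| + L ^ 2 / 2 * (J ^ 2)⁻¹ * vp ^ 2))) := by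
  have t3 : |rp * Rq| ≤ (rp ^ 2 + Rq ^ 2) / 2 := by
    rw [abs_le]
    constructor <;> nlinarith [sq_nonneg (rp - Rq), sq_nonneg (rp + Rq)]
  have t4 : |vp * Rq| ≤ ((J ^ 2)⁻¹ * vp ^ 2 + J ^ 2 * Rq ^ 2) / 2 := by
    have e1 : vp * Rq = (J⁻¹ * vp) * (J * Rq) := by field_simp
    have e2 : (J ^ 2)⁻¹ * vp ^ 2 + J ^ 2 * Rq ^ 2 = (J⁻¹ * vp) ^ 2 + (J * Rq) ^ 2 := by
      rw [mul_pow, mul_pow, inv_pow]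
    rw [e1, e2, abs_le]
    constructor <;> nlinarith [sq_nonneg (J⁻¹ * vp - J * Rq), sq_nonneg (J⁻¹ * vp + J * Rq)]
  have t5 : |(up - vp) * Rq| ≤ (3 / J) * |up| + ((J ^ 2)⁻¹ * vp ^ 2 + J ^ 2 * Rq ^ 2) / 2 := by
    rw [sub_mul]
    calc _ ≤ |up * Rq| + |vp * Rq| := abs_sub _ _
      _ ≤ |up| * (3 / J) + ((J ^ 2)⁻¹ * vp ^ 2 + J ^ 2 * Rq ^ 2) / 2 := by
        rw [abs_mul up]; gcongr
      _ = _ := by ring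
  calc _ ≤ |g1| * |rp * Rq| + |g2| * |(up - vp) * Rq| := by
        rw [← abs_mul, ← abs_mul]; exact abs_add_le _ _
    _ ≤ (ρ * K1) * ((rp ^ 2 + Rq ^ 2) / 2) + (ρ * L ^ 2) *
        ((3 / J) * |up| + ((J ^ 2)⁻¹ * vp ^ 2 + J ^ 2 * Rq ^ 2) / 2) := by gcongr
    _ = _ := by ring

set_option maxHeartbeats 1000000 in
lemma offdiag (ξ a b : ℝ) (hξ : 0 < ξ) (ha : 1 < a) (hab : a < b) (r u v R : ℝ → ℝ)
    (hr : ∀ x, HasDerivAt r (u x - v x) x) (hu : Continuous u) (hv : Continuous v)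
    (hR : ∀ x, HasDerivAt R (r x) x) (pr : ∀ x, r (x + 1) = r x) (pu : ∀ x, u (x + 1) = u x)
    (pv : ∀ x, v (x + 1) = v x) (pR : ∀ x, R (x + 1) = R x) (J : ℝ) (hJ : 1 ≤ J)
    (h1 : (∫ x in (0:ℝ)..1, r x ^ 2) ≤ 4 / J) (h2 : (∫ x in (0:ℝ)..1, R x ^ 2) ≤ 1 / J ^ 3)
    (h3 : (∫ x in (0:ℝ)..1, |u x|) ≤ 6) (h4 : (∫ x in (0:ℝ)..1, v x ^ 2) ≤ 144 * J)
    (h5 : ∀ x, |R x| ≤ 3 / J) (p q : ℕ) (hp : 1 ≤ p) (hpq : p < q) :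
    |∫ x in a..b, (x - a) * (b - x) * (r (ξ * x ^ p) * r (ξ * x ^ q))| ≤
      ((b - a) + 2 / ξ) * (3 * ((b - a) + (b - a) ^ 2) / ξ + 91 * (b - a) ^ 2) *
        (a⁻¹) ^ (q - p) / J := by
  have hrc : Continuous r := continuous_iff_continuousAt.2 fun x => (hr x).continuousAt
  have hRc : Continuous R := continuous_iff_continuousAt.2 fun x => (hR x).continuousAt
  obtain ⟨l, rfl⟩ : ∃ l, p = l + 1 := ⟨p - 1, by omega⟩
  obtain ⟨k, rfl⟩ : ∃ k, q = k + 1 := ⟨q - 1, by omega⟩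
  have hJ0 : 0 < J := by linarith
  have ha0 : 0 < a := by linarith
  have hL : 0 < b - a := by linarith
  set C0 := (b - a) + 2 / ξ with hC0
  have hC0p : 0 < C0 := by positivity
  set L := b - a with hLdef
  set ρ := (a⁻¹) ^ (k + 1 - (l + 1)) with hρ
  have hρ0 : 0 < ρ := by positivity
  have hpos : ∀ x ∈ Set.uIcc a b, 0 < x := by
    intro x hx
    rw [Set.uIcc_of_le hab.le] at hx
    linarith [hx.1]
  set c : ℝ := (ξ * (k + 1 : ℕ))⁻¹ with hcdef
  have hc0 : 0 < c := by positivity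
  set w : ℝ → ℝ := fun x => (x - a) * (b - x) with hw
  set w' : ℝ → ℝ := fun x => (b - x) - (x - a) with hw'
  have hwd : ∀ x, HasDerivAt w (w' x) x := by
    intro x
    have := ((hasDerivAt_id x).sub_const a).mul ((hasDerivAt_id x).const_sub b)
    refine this.congr_deriv ?_
    simp [hw']; ring
  set G : ℝ → ℝ := fun x => c * (x ^ k)⁻¹ with hG
  set G' : ℝ → ℝ := fun x => c * (-(k * (x ^ (k + 1))⁻¹)) with hG'
  have hGd : ∀ x, 0 < x → HasDerivAt G (G' x) x := fun x hx => (inv_pow_deriv k x hx).const_mul c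
  have hGc : ContinuousOn G (Set.uIcc a b) := fun x hx =>
    (hGd x (hpos x hx)).continuousAt.continuousWithinAt
  have hG'c : ContinuousOn G' (Set.uIcc a b) := by
    apply ContinuousOn.mul continuousOn_const
    apply ContinuousOn.neg
    apply ContinuousOn.mul continuousOn_const
    apply ContinuousOn.inv₀ (by fun_prop)
    intro x hx
    have := hpos x hx
    positivity
  set T : ℝ → ℝ := fun x =>
    ((w' x * G x + w x * G' x) * r (ξ * x ^ (l + 1)) +
      w x * G x * ((u (ξ * x ^ (l + 1)) - v (ξ * x ^ (l + 1))) * (ξ * ((l + 1 : ℕ) * x ^ l)))) *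
      R (ξ * x ^ (k + 1)) with hT
  have hTc : ContinuousOn T (Set.uIcc a b) := by
    have : ContinuousOn w (Set.uIcc a b) := by fun_prop
    have : ContinuousOn w' (Set.uIcc a b) := by fun_prop
    fun_prop
  have hP : ∀ x ∈ Set.uIcc a b,
      HasDerivAt (fun x => (w x * G x) * r (ξ * x ^ (l + 1)) * R (ξ * x ^ (k + 1)))
      (w x * (r (ξ * x ^ (l + 1)) * r (ξ * x ^ (k + 1))) + T x) x := by
    intro x hx
    have hx0 := hpos x hx
    have := ((((hwd x).mul (hGd x hx0)).mul
      ((hr (ξ * x ^ (l + 1))).comp x (mono_deriv ξ l x)))).mul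
      ((hR (ξ * x ^ (k + 1))).comp x (mono_deriv ξ k x))
    refine this.congr_deriv ?_
    have hg : G x * (ξ * ((k + 1 : ℕ) * x ^ k)) = 1 := by
      simp only [hG, hcdef]
      field_simp
    simp only [hT, Function.comp, Pi.mul_apply]
    linear_combination (w x * r (ξ * x ^ (l + 1)) * r (ξ * x ^ (k + 1))) * hg
  have hi1 : IntervalIntegrable (fun x => w x * (r (ξ * x ^ (l + 1)) * r (ξ * x ^ (k + 1))))
      volume a b := by
    have : Continuous w := by fun_prop
    exact Continuous.intervalIntegrable (by fun_prop) _ _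
  have key := intervalIntegral.integral_eq_sub_of_hasDerivAt hP (hi1.add hTc.intervalIntegrable)
  rw [intervalIntegral.integral_add hi1 hTc.intervalIntegrable] at key
  have hwa : w a = 0 := by simp [hw]
  have hwb : w b = 0 := by simp [hw]
  rw [hwa, hwb] at key
  have key2 : (∫ x in a..b, w x * (r (ξ * x ^ (l + 1)) * r (ξ * x ^ (k + 1)))) =
      - ∫ x in a..b, T x := by linarith
  change |∫ x in a..b, w x * (r (ξ * x ^ (l + 1)) * r (ξ * x ^ (k + 1)))| ≤ _
  rw [key2, abs_neg]
  set K1 := (L + L ^ 2) / ξ with hK1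
  have hK10 : 0 < K1 := by positivity
  set H : ℝ → ℝ := fun x =>
    (K1 / 2) * r (ξ * x ^ (l + 1)) ^ 2 + ((K1 / 2 + L ^ 2 / 2 * J ^ 2) * R (ξ * x ^ (k + 1)) ^ 2 +
    (L ^ 2 * (3 / J) * |u (ξ * x ^ (l + 1))| + L ^ 2 / 2 * (J ^ 2)⁻¹ * v (ξ * x ^ (l + 1)) ^ 2))
    with hH
  have hbound : ∀ x ∈ Set.Icc a b, |T x| ≤ ρ * H x := by
    intro x hx
    have hx0 : 0 < x := by linarith [hx.1]
    have hw1 : |w x| ≤ L ^ 2 := by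
      have i1 : 0 ≤ x - a := by linarith [hx.1]
      have i2 : 0 ≤ b - x := by linarith [hx.2]
      simp only [hw]
      rw [abs_of_nonneg (mul_nonneg i1 i2), sq]
      apply mul_le_mul <;> linarith
    have hw2 : |w' x| ≤ L := by
      simp only [hw', abs_le]; constructor <;> linarith [hx.1, hx.2]
    have hcle : c ≤ ξ⁻¹ := by
      rw [hcdef]
      apply inv_anti₀ hξ
      have h1 : (1:ℝ) ≤ (k + 1 : ℕ) := Nat.one_le_cast.2 (by omega)
      nlinarith
    have hckle : c * k ≤ ξ⁻¹ := by
      rw [hcdef, ← div_eq_inv_mul, inv_eq_one_div, div_le_div_iff₀ (by positivity) hξ]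
      push_cast; nlinarith
    have hinv : ∀ n, k + 1 - (l + 1) ≤ n → (x ^ n)⁻¹ ≤ ρ := by
      intro n hn
      rw [hρ, inv_pow]
      apply inv_anti₀ (by positivity)
      calc a ^ (k + 1 - (l + 1)) ≤ a ^ n := pow_le_pow_right₀ ha.le hn
        _ ≤ x ^ n := by gcongr; exact hx.1
    have hG1 : |G x| ≤ ξ⁻¹ * ρ := by
      simp only [hG]
      rw [abs_of_pos (by positivity)]
      have := hinv k (by omega)
      gcongr
    have hG2 : |G' x| ≤ ξ⁻¹ * ρ := by
      simp only [hG']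
      rw [mul_neg, abs_neg, ← mul_assoc, abs_of_nonneg (by positivity)]
      have := hinv (k + 1) (by omega)
      gcongr
    have hG3 : |G x * (ξ * ((l + 1 : ℕ) * x ^ l))| ≤ ρ := by
      rw [abs_of_nonneg (by simp only [hG]; positivity)]
      have e : G x * (ξ * ((l + 1 : ℕ) * x ^ l)) =
          ((l + 1 : ℕ) / (k + 1 : ℕ) : ℝ) * (x ^ (k + 1 - (l + 1)))⁻¹ := by
        simp only [hG, hcdef]
        have : x ^ k = x ^ l * x ^ (k + 1 - (l + 1)) := by
          rw [← pow_add]; congr 1; omega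
        rw [this]
        field_simp
      rw [e]
      have h1 : ((l + 1 : ℕ) / (k + 1 : ℕ) : ℝ) ≤ 1 := by
        rw [div_le_one (by positivity)]
        exact_mod_cast hpq.le
      calc _ ≤ 1 * ρ := by
            gcongr
            exact hinv _ le_rfl
        _ = ρ := one_mul _
    set rp := r (ξ * x ^ (l + 1))
    set up := u (ξ * x ^ (l + 1))
    set vp := v (ξ * x ^ (l + 1))
    set Rq := R (ξ * x ^ (k + 1)) with hRq
    have hRq3 : |Rq| ≤ 3 / J := h5 _
    have eT : T x = (w' x * G x + w x * G' x) * (rp * Rq) +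
        (w x * (G x * (ξ * ((l + 1 : ℕ) * x ^ l)))) * ((up - vp) * Rq) := by
      simp only [hT]; ring
    have t1 : |w' x * G x + w x * G' x| ≤ ρ * K1 := by
      calc _ ≤ |w' x * G x| + |w x * G' x| := abs_add_le _ _
        _ = |w' x| * |G x| + |w x| * |G' x| := by rw [abs_mul (w' x) (G x), abs_mul (w x) (G' x)]
        _ ≤ L * (ξ⁻¹ * ρ) + L ^ 2 * (ξ⁻¹ * ρ) := by gcongr
        _ = ρ * K1 := by rw [hK1]; ring
    have t2 : |w x * (G x * (ξ * ((l + 1 : ℕ) * x ^ l)))| ≤ ρ * L ^ 2 := by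
      rw [abs_mul]
      calc _ ≤ L ^ 2 * ρ := by gcongr
        _ = _ := by ring
    rw [eT]
    refine (pw_alg _ _ rp up vp Rq J ρ K1 L hJ0 hρ0 hK10 t1 t2 hRq3).trans_eq ?_
    simp only [hH, rp, up, vp, hRq]
  have c1 := comp_bound ξ a b hξ ha hab (fun x => r x ^ 2) (by fun_prop) (fun x => sq_nonneg _)
    (fun x => by simp [pr]) (l + 1) (by omega)
  have c2 := comp_bound ξ a b hξ ha hab (fun x => R x ^ 2) (by fun_prop) (fun x => sq_nonneg _)
    (fun x => by simp [pR]) (k + 1) (by omega)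
  have c3 := comp_bound ξ a b hξ ha hab (fun x => |u x|) (by fun_prop) (fun x => abs_nonneg _)
    (fun x => by simp [pu]) (l + 1) (by omega)
  have c4 := comp_bound ξ a b hξ ha hab (fun x => v x ^ 2) (by fun_prop) (fun x => sq_nonneg _)
    (fun x => by simp [pv]) (l + 1) (by omega)
  rw [← hLdef, ← hC0] at c1 c2 c3 c4
  have hHint : (∫ x in a..b, H x) =
      (K1 / 2) * (∫ x in a..b, r (ξ * x ^ (l + 1)) ^ 2) +
      ((K1 / 2 + L ^ 2 / 2 * J ^ 2) * (∫ x in a..b, R (ξ * x ^ (k + 1)) ^ 2) +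
      (L ^ 2 * (3 / J) * (∫ x in a..b, |u (ξ * x ^ (l + 1))|) +
        L ^ 2 / 2 * (J ^ 2)⁻¹ * ∫ x in a..b, v (ξ * x ^ (l + 1)) ^ 2)) := by
    simp only [hH]
    rw [intervalIntegral.integral_add (Continuous.intervalIntegrable (by fun_prop) _ _)
      (Continuous.intervalIntegrable (by fun_prop) _ _),
      intervalIntegral.integral_add (Continuous.intervalIntegrable (by fun_prop) _ _)
      (Continuous.intervalIntegrable (by fun_prop) _ _),
      intervalIntegral.integral_add (Continuous.intervalIntegrable (by fun_prop) _ _)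
      (Continuous.intervalIntegrable (by fun_prop) _ _)]
    simp only [intervalIntegral.integral_const_mul]
  have hHle : (∫ x in a..b, H x) ≤ C0 * (3 * K1 + 91 * L ^ 2) / J := by
    rw [hHint]
    have hJ3 : 1 / J ^ 3 ≤ 1 / J :=
      one_div_le_one_div_of_le hJ0 (le_self_pow₀ hJ (by norm_num))
    calc _ ≤ (K1 / 2) * (C0 * (4 / J)) + ((K1 / 2 + L ^ 2 / 2 * J ^ 2) * (C0 * (1 / J ^ 3)) +
      (L ^ 2 * (3 / J) * (C0 * 6) + L ^ 2 / 2 * (J ^ 2)⁻¹ * (C0 * (144 * J)))) := by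
          have d1 := c1.trans (mul_le_mul_of_nonneg_left h1 hC0p.le)
          have d2 := c2.trans (mul_le_mul_of_nonneg_left h2 hC0p.le)
          have d3 := c3.trans (mul_le_mul_of_nonneg_left h3 hC0p.le)
          have d4 := c4.trans (mul_le_mul_of_nonneg_left h4 hC0p.le)
          gcongr
      _ = (K1 / 2) * (C0 * (4 / J)) + (K1 / 2) * C0 * (1 / J ^ 3) + L ^ 2 / 2 * C0 * (1 / J) +
          L ^ 2 * 18 * C0 * (1 / J) + L ^ 2 * 72 * C0 * (1 / J) := by
          field_simp; ring
      _ ≤ (K1 / 2) * (C0 * (4 / J)) + (K1 / 2) * C0 * (1 / J) + L ^ 2 / 2 * C0 * (1 / J) +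
          L ^ 2 * 18 * C0 * (1 / J) + L ^ 2 * 72 * C0 * (1 / J) := by gcongr
      _ = C0 * (2.5 * K1 + 90.5 * L ^ 2) / J := by ring
      _ ≤ _ := by gcongr <;> norm_num
  have hHc : Continuous H := by simp only [hH]; fun_prop
  calc |∫ x in a..b, T x| ≤ ∫ x in a..b, |T x| :=
        intervalIntegral.abs_integral_le_integral_abs hab.le
    _ ≤ ∫ x in a..b, ρ * H x := by
        apply intervalIntegral.integral_mono_on hab.le hTc.abs.intervalIntegrable
          (Continuous.intervalIntegrable (by fun_prop) _ _) hbound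
    _ = ρ * ∫ x in a..b, H x := by rw [intervalIntegral.integral_const_mul]
    _ ≤ ρ * (C0 * (3 * K1 + 91 * L ^ 2) / J) := by gcongr
    _ = _ := by rw [hK1]; ring

/-! ### The smooth case -/

lemma geom_inj (ρ : ℝ) (h0 : 0 ≤ ρ) (h1 : ρ < 1) (F : Finset ℕ) (g : ℕ → ℕ)
    (hg : Set.InjOn g F) : ∑ n ∈ F, ρ ^ (g n) ≤ (1 - ρ)⁻¹ := by
  rw [← Finset.sum_image (f := fun i => ρ ^ i) (g := g) hg, ← tsum_geometric_of_lt_one h0 h1]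
  exact (summable_geometric_of_lt_one h0 h1).sum_le_tsum _ fun i _ => pow_nonneg h0 i

lemma geom_row (ρ : ℝ) (h0 : 0 ≤ ρ) (h1 : ρ < 1) (F : Finset ℕ) (m : ℕ) :
    ∑ n ∈ F, ρ ^ ((n - m) + (m - n)) ≤ 2 * (1 - ρ)⁻¹ := by
  rw [← Finset.sum_filter_add_sum_filter_not F (fun n => m ≤ n), two_mul]
  apply add_le_add
  · apply geom_inj ρ h0 h1 _ (fun n => (n - m) + (m - n))
    intro x hx y hy hxy
    simp at hx hy hxy
    omega
  · apply geom_inj ρ h0 h1 _ (fun n => (n - m) + (m - n))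
    intro x hx y hy hxy
    simp at hx hy hxy
    omega

lemma pair_bound (ξ a b : ℝ) (hξ : 0 < ξ) (ha : 1 < a) (hab : a < b) (r u v R : ℝ → ℝ)
    (hr : ∀ x, HasDerivAt r (u x - v x) x) (hu : Continuous u) (hv : Continuous v)
    (hR : ∀ x, HasDerivAt R (r x) x) (pr : ∀ x, r (x + 1) = r x) (pu : ∀ x, u (x + 1) = u x)
    (pv : ∀ x, v (x + 1) = v x) (pR : ∀ x, R (x + 1) = R x) (J : ℝ) (hJ : 1 ≤ J)
    (h1 : (∫ x in (0:ℝ)..1, r x ^ 2) ≤ 4 / J) (h2 : (∫ x in (0:ℝ)..1, R x ^ 2) ≤ 1 / J ^ 3)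
    (h3 : (∫ x in (0:ℝ)..1, |u x|) ≤ 6) (h4 : (∫ x in (0:ℝ)..1, v x ^ 2) ≤ 144 * J)
    (h5 : ∀ x, |R x| ≤ 3 / J) (p q : ℕ) (hp : 1 ≤ p) (hq : 1 ≤ q) :
    (∫ x in a..b, (x - a) * (b - x) * (r (ξ * x ^ p) * r (ξ * x ^ q))) ≤
      ((b - a) + 2 / ξ) * (3 * ((b - a) + (b - a) ^ 2) / ξ + 91 * (b - a) ^ 2) *
        (a⁻¹) ^ ((q - p) + (p - q)) / J := by
  have hrc : Continuous r := continuous_iff_continuousAt.2 fun x => (hr x).continuousAt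
  rcases lt_trichotomy p q with h | h | h
  · rw [show (q - p) + (p - q) = q - p by omega]
    exact (le_abs_self _).trans (offdiag ξ a b hξ ha hab r u v R hr hu hv hR pr pu pv pR J hJ
      h1 h2 h3 h4 h5 p q hp h)
  · subst h
    have hL : 0 < b - a := by linarith
    have c1 := comp_bound ξ a b hξ ha hab (fun x => r x ^ 2) (by fun_prop) (fun x => sq_nonneg _)
      (fun x => by simp [pr]) p hp
    simp only [Nat.sub_self, add_zero, pow_zero, mul_one]
    have hJ0 : 0 < J := by linarith
    calc _ ≤ ∫ x in a..b, (b - a) ^ 2 * r (ξ * x ^ p) ^ 2 := by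
          apply intervalIntegral.integral_mono_on hab.le
            (Continuous.intervalIntegrable (by fun_prop) _ _)
            (Continuous.intervalIntegrable (by fun_prop) _ _)
          intro x hx
          have i1 : 0 ≤ x - a := by linarith [hx.1]
          have i2 : 0 ≤ b - x := by linarith [hx.2]
          rw [← sq]
          apply mul_le_mul_of_nonneg_right _ (sq_nonneg _)
          rw [sq]
          apply mul_le_mul <;> linarith
      _ = (b - a) ^ 2 * ∫ x in a..b, r (ξ * x ^ p) ^ 2 := by
          rw [intervalIntegral.integral_const_mul]
      _ ≤ (b - a) ^ 2 * (((b - a) + 2 / ξ) * (4 / J)) := by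
          apply mul_le_mul_of_nonneg_left _ (sq_nonneg _)
          exact c1.trans (mul_le_mul_of_nonneg_left h1 (by positivity))
      _ = ((b - a) + 2 / ξ) * (0 + 4 * (b - a) ^ 2) / J := by ring
      _ ≤ _ := by
          have : 0 ≤ 3 * ((b - a) + (b - a) ^ 2) / ξ := by positivity
          gcongr
          norm_num
  · rw [show (q - p) + (p - q) = p - q by omega]
    have := (le_abs_self _).trans (offdiag ξ a b hξ ha hab r u v R hr hu hv hR pr pu pv pR J hJ
      h1 h2 h3 h4 h5 q p hq h)
    refine le_trans (le_of_eq ?_) this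
    congr 1
    ext x
    ring

noncomputable def bigC (ξ a b : ℝ) : ℝ :=
  ((b - a) + 2 / ξ) * (3 * ((b - a) + (b - a) ^ 2) / ξ + 91 * (b - a) ^ 2)

lemma smooth_case (ξ A B : ℝ) (hξ : 0 < ξ) (hA : 1 < A) (hAB : B - A = 1)
    (s : ℕ → ℕ) (hs : StrictMono s) (hs1 : ∀ n, 1 ≤ n → 1 ≤ s n)
    (f f' : ℝ → ℝ) (hd : ∀ x, HasDerivAt f (f' x) x) (hc : Continuous f')
    (hp : ∀ x, f (x + 1) = f x) (hp' : ∀ x, f' (x + 1) = f' x)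
    (h0 : (∫ x in (0:ℝ)..1, f x) = 0)
    (hV : (∫ x in (0:ℝ)..1, |f' x|) ≤ 6) (J N : ℕ) (hJ : 1 ≤ J) :
    (∫ x in A..B, (∑ n ∈ Finset.Icc 1 N,
      (f (ξ * x ^ s n) - fourierPartial f J (ξ * x ^ s n))) ^ 2) ≤
      (((A - 1) / 2)⁻¹ * (bigC ξ ((1 + A) / 2) (B + 1) *
        (2 * (1 - ((1 + A) / 2)⁻¹)⁻¹))) * N / J := by
  obtain ⟨R, hR, pR, i1, i2, i3, i4⟩ := remainder f f' hd hc hp h0 hV J hJ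
  set a := (1 + A) / 2 with haf
  set b := B + 1 with hbdef
  have ha : 1 < a := by rw [haf]; linarith
  have hab : a < b := by rw [haf, hbdef]; linarith
  have hL : 0 < b - a := by linarith
  have hK : 0 < bigC ξ a b := by unfold bigC; positivity
  have hJ1 : (1:ℝ) ≤ J := by exact_mod_cast hJ
  have hJ0 : (0:ℝ) < J := by linarith
  set r : ℝ → ℝ := fun x => f x - fourierPartial f J x with hr
  have hrd : ∀ x, HasDerivAt r (f' x - fpd f J x) x := fun x => (hd x).sub (fpd_deriv f J x)
  have hrc : Continuous r := continuous_iff_continuousAt.2 fun x => (hrd x).continuousAt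
  have hρ0 : 0 ≤ a⁻¹ := by positivity
  have hρ1 : a⁻¹ < 1 := inv_lt_one_of_one_lt₀ ha
  have pb := pair_bound ξ a b hξ ha hab r f' (fpd f J) R hrd hc (fpd_continuous f J) hR
    (fun x => by simp only [hr, hp, fp_per]) hp' (fpd_per f J) pR J hJ1 i1 i2 hV i3 i4
  have hSc : Continuous fun x : ℝ => ∑ n ∈ Finset.Icc 1 N, r (ξ * x ^ s n) := by fun_prop
  have hκ : 0 < (A - 1) / 2 := by linarith
  have step1 : (∫ x in A..B, (∑ n ∈ Finset.Icc 1 N, r (ξ * x ^ s n)) ^ 2) ≤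
      ((A - 1) / 2)⁻¹ * ∫ x in a..b, (x - a) * (b - x) *
        (∑ n ∈ Finset.Icc 1 N, r (ξ * x ^ s n)) ^ 2 := by
    rw [← intervalIntegral.integral_const_mul]
    have hcc : Continuous fun x : ℝ => ((A - 1) / 2)⁻¹ * ((x - a) * (b - x) *
        (∑ n ∈ Finset.Icc 1 N, r (ξ * x ^ s n)) ^ 2) := by fun_prop
    calc _ ≤ ∫ x in A..B, ((A - 1) / 2)⁻¹ * ((x - a) * (b - x) *
        (∑ n ∈ Finset.Icc 1 N, r (ξ * x ^ s n)) ^ 2) := by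
          apply intervalIntegral.integral_mono_on (by linarith)
            (Continuous.intervalIntegrable (by fun_prop) _ _) (hcc.intervalIntegrable _ _)
          intro x hx
          rw [← mul_assoc]
          apply le_mul_of_one_le_left (sq_nonneg _)
          rw [← div_eq_inv_mul, one_le_div hκ]
          have j1 : (A - 1) / 2 ≤ x - a := by rw [haf]; linarith [hx.1]
          have j2 : 1 ≤ b - x := by rw [hbdef]; linarith [hx.2]
          nlinarith
      _ ≤ _ := by
          apply intervalIntegral.integral_mono_interval (by rw [haf]; linarith) (by linarith)
            (by rw [hbdef]; linarith) _ (hcc.intervalIntegrable _ _)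
          refine (ae_restrict_iff' measurableSet_Ioc).2 (Eventually.of_forall fun x hx => ?_)
          have j1 : 0 ≤ x - a := by linarith [hx.1]
          have j2 : 0 ≤ b - x := by linarith [hx.2]
          simp only [Pi.zero_apply]
          positivity
  have step2 : (∫ x in a..b, (x - a) * (b - x) * (∑ n ∈ Finset.Icc 1 N, r (ξ * x ^ s n)) ^ 2) =
      ∑ m ∈ Finset.Icc 1 N, ∑ n ∈ Finset.Icc 1 N,
        ∫ x in a..b, (x - a) * (b - x) * (r (ξ * x ^ s m) * r (ξ * x ^ s n)) := by
    have : ∀ m ∈ Finset.Icc 1 N, (∑ n ∈ Finset.Icc 1 N,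
        ∫ x in a..b, (x - a) * (b - x) * (r (ξ * x ^ s m) * r (ξ * x ^ s n))) =
        ∫ x in a..b, ∑ n ∈ Finset.Icc 1 N,
          (x - a) * (b - x) * (r (ξ * x ^ s m) * r (ξ * x ^ s n)) := by
      intro m _
      rw [intervalIntegral.integral_finsetSum]
      intro n _
      exact Continuous.intervalIntegrable (by fun_prop) _ _
    rw [Finset.sum_congr rfl this, ← intervalIntegral.integral_finsetSum]
    · congr 1
      ext x
      rw [sq, Finset.sum_mul_sum, Finset.mul_sum]
      refine Finset.sum_congr rfl fun m _ => ?_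
      rw [Finset.mul_sum]
    · intro n _
      exact Continuous.intervalIntegrable (by fun_prop) _ _
  have hsub : ∀ m n, m ≤ n → n - m ≤ s n - s m := by
    intro m n hmn
    have : s m + (n - m) ≤ s n := by
      have := hs.add_le_nat (n - m) m
      rwa [show n - m + m = n by omega, add_comm] at this
    omega
  have step3 : (∑ m ∈ Finset.Icc 1 N, ∑ n ∈ Finset.Icc 1 N,
        ∫ x in a..b, (x - a) * (b - x) * (r (ξ * x ^ s m) * r (ξ * x ^ s n))) ≤
      ∑ m ∈ Finset.Icc 1 N, bigC ξ a b * (2 * (1 - a⁻¹)⁻¹) / J := by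
    apply Finset.sum_le_sum
    intro m hm
    calc _ ≤ ∑ n ∈ Finset.Icc 1 N, bigC ξ a b / J * (a⁻¹) ^ ((n - m) + (m - n)) := by
          apply Finset.sum_le_sum
          intro n hn
          rw [Finset.mem_Icc] at hm hn
          refine (pb (s m) (s n) (hs1 m hm.1) (hs1 n hn.1)).trans ?_
          change bigC ξ a b * _ / J ≤ _
          rw [mul_div_right_comm]
          apply mul_le_mul_of_nonneg_left _ (by positivity)
          apply pow_le_pow_of_le_one hρ0 hρ1.le
          rcases le_total m n with h | h
          · have := hsub m n h; omega
          · have := hsub n m h; omega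
      _ = bigC ξ a b / J * ∑ n ∈ Finset.Icc 1 N, (a⁻¹) ^ ((n - m) + (m - n)) := by
          rw [Finset.mul_sum]
      _ ≤ bigC ξ a b / J * (2 * (1 - a⁻¹)⁻¹) :=
          mul_le_mul_of_nonneg_left (geom_row _ hρ0 hρ1 _ _) (by positivity)
      _ = _ := by ring
  rw [step2] at step1
  refine step1.trans ?_
  refine (mul_le_mul_of_nonneg_left step3 (by positivity)).trans_eq ?_
  simp only [Finset.sum_const, Nat.card_Icc, Nat.add_sub_cancel, nsmul_eq_mul]
  ring

/-! ### Regularization -/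

noncomputable def stek (h : ℝ) (f : ℝ → ℝ) (x : ℝ) : ℝ := (∫ t in x..(x + h), f t) / h

lemma stek_eq (h : ℝ) (f : ℝ → ℝ) (hf : ∀ a b, IntervalIntegrable f volume a b) (x : ℝ) :
    stek h f x = ((∫ t in (0:ℝ)..(x + h), f t) - ∫ t in (0:ℝ)..x, f t) / h := by
  rw [stek, intervalIntegral.integral_interval_sub_left (hf _ _) (hf _ _)]

lemma prim_cont (f : ℝ → ℝ) (hf : ∀ a b, IntervalIntegrable f volume a b) :
    Continuous fun x => ∫ t in (0:ℝ)..x, f t :=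
  intervalIntegral.continuous_primitive hf 0

lemma stek_cont (h : ℝ) (f : ℝ → ℝ) (hf : ∀ a b, IntervalIntegrable f volume a b) :
    Continuous (stek h f) := by
  have e : stek h f = fun x => ((∫ t in (0:ℝ)..(x + h), f t) - ∫ t in (0:ℝ)..x, f t) / h :=
    funext (stek_eq h f hf)
  rw [e]
  have h1 := prim_cont f hf
  exact ((h1.comp (continuous_id.add continuous_const)).sub h1).div_const h

lemma stek_deriv (h : ℝ) (g : ℝ → ℝ) (hg : Continuous g) (x : ℝ) :
    HasDerivAt (stek h g) ((g (x + h) - g x) / h) x := by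
  have e : stek h g = fun x => ((∫ t in (0:ℝ)..(x + h), g t) - ∫ t in (0:ℝ)..x, g t) / h :=
    funext (stek_eq h g fun a b => hg.intervalIntegrable a b)
  rw [e]
  have h1 : ∀ y, HasDerivAt (fun y => ∫ t in (0:ℝ)..y, g t) (g y) y := fun y =>
    intervalIntegral.integral_hasDerivAt_right (hg.intervalIntegrable _ _)
      (hg.stronglyMeasurableAtFilter _ _) hg.continuousAt
  exact (((h1 (x + h)).comp_add_const x h).sub (h1 x)).div_const h

lemma stek_per (h : ℝ) (f : ℝ → ℝ) (hp : ∀ x, f (x + 1) = f x) (x : ℝ) :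
    stek h f (x + 1) = stek h f x := by
  unfold stek
  congr 1
  rw [show x + 1 + h = (x + h) + 1 by ring, ← intervalIntegral.integral_comp_add_right]
  simp only [hp]

lemma stek_mean (h : ℝ) (f : ℝ → ℝ) (hf : ∀ a b, IntervalIntegrable f volume a b)
    (hp : ∀ x, f (x + 1) = f x) (h0 : (∫ x in (0:ℝ)..1, f x) = 0) :
    (∫ x in (0:ℝ)..1, stek h f x) = 0 := by
  set F : ℝ → ℝ := fun x => ∫ t in (0:ℝ)..x, f t with hF
  have hFc : Continuous F := prim_cont f hf
  have hFp : Function.Periodic F 1 := by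
    intro x
    have h1 : F (x + 1) = F x + ∫ t in x..(x+1), f t := by
      simp only [hF]
      rw [intervalIntegral.integral_add_adjacent_intervals (hf _ _) (hf _ _)]
    have h2 := (show Function.Periodic f 1 from hp).intervalIntegral_add_eq x 0
    rw [zero_add, h0] at h2
    rw [h1, h2, add_zero]
  have e : stek h f = fun x => (F (x + h) - F x) / h := funext (stek_eq h f hf)
  rw [e, intervalIntegral.integral_div, intervalIntegral.integral_sub
    (Continuous.intervalIntegrable (by fun_prop) _ _) (hFc.intervalIntegrable _ _),
    intervalIntegral.integral_comp_add_right (fun x => F x)]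
  have := hFp.intervalIntegral_add_eq h 0
  rw [zero_add] at this
  rw [zero_add, add_comm 1 h, this, sub_self, zero_div]

lemma stek_le (h : ℝ) (hh : 0 < h) (f : ℝ → ℝ) (hf : ∀ a b, IntervalIntegrable f volume a b)
    (x K : ℝ) (hK : ∀ t ∈ Set.Icc x (x + h), f t ≤ K) : stek h f x ≤ K := by
  unfold stek
  rw [div_le_iff₀ hh]
  calc _ ≤ ∫ t in x..(x + h), K :=
        intervalIntegral.integral_mono_on (by linarith) (hf _ _) (by simp) hK
    _ = K * h := by simp; ring

lemma le_stek (h : ℝ) (hh : 0 < h) (f : ℝ → ℝ) (hf : ∀ a b, IntervalIntegrable f volume a b)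
    (x K : ℝ) (hK : ∀ t ∈ Set.Icc x (x + h), K ≤ f t) : K ≤ stek h f x := by
  unfold stek
  rw [le_div_iff₀ hh]
  calc K * h = ∫ t in x..(x + h), K := by simp; ring
    _ ≤ _ := intervalIntegral.integral_mono_on (by linarith) (by simp) (hf _ _) hK

lemma stek_mono (h : ℝ) (hh : 0 < h) (f : ℝ → ℝ) (hm : Monotone f) : Monotone (stek h f) := by
  intro x y hxy
  unfold stek
  apply div_le_div_of_nonneg_right _ hh.le
  have e : ∀ z, (∫ t in z..(z + h), f t) = ∫ t in (0:ℝ)..h, f (z + t) := by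
    intro z
    rw [intervalIntegral.integral_comp_add_left, add_zero]
  rw [e, e]
  apply intervalIntegral.integral_mono_on hh.le
  · exact Monotone.intervalIntegrable fun a b hab => hm (by linarith)
  · exact Monotone.intervalIntegrable fun a b hab => hm (by linarith)
  · intro t _
    exact hm (by linarith)

lemma stek_sub (h : ℝ) (p q : ℝ → ℝ) (hp : ∀ a b, IntervalIntegrable p volume a b)
    (hq : ∀ a b, IntervalIntegrable q volume a b) (x : ℝ) :
    stek h (p - q) x = stek h p x - stek h q x := by
  unfold stek
  rw [← sub_div, ← intervalIntegral.integral_sub (hp _ _) (hq _ _)]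
  rfl

lemma stek_incr (h : ℝ) (hh : 0 < h) (h1 : h ≤ 1) (p : ℝ → ℝ) (hm : Monotone p) :
    (∫ x in (0:ℝ)..1, (stek h p (x + h) - stek h p x) / h) ≤ p 3 - p 0 := by
  have hpi : ∀ a b, IntervalIntegrable p volume a b := fun a b => hm.intervalIntegrable
  set P := stek h p with hP
  have hPc : Continuous P := stek_cont h p hpi
  have hPm : Monotone P := stek_mono h hh p hm
  have e := intervalIntegral.integral_eq_sub_of_hasDerivAt (a := 0) (b := 1)
    (fun x _ => stek_deriv h P hPc x) (Continuous.intervalIntegrable (by fun_prop) _ _)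
  rw [e]
  have i1 : stek h P 1 ≤ p 3 := by
    apply stek_le h hh P (fun a b => hPc.intervalIntegrable a b)
    intro t ht
    apply stek_le h hh p hpi
    intro u hu
    exact hm (by linarith [ht.2, hu.2])
  have i2 : p 0 ≤ stek h P 0 := by
    apply le_stek h hh P (fun a b => hPc.intervalIntegrable a b)
    intro t ht
    apply le_stek h hh p hpi
    intro u hu
    exact hm (by linarith [ht.1, hu.1])
  linarith

lemma var_int (f : ℝ → ℝ) (hp : ∀ x, f (x + 1) = f x)
    (hV : eVariationOn f (Set.Icc (0:ℝ) 1) ≤ 2) (z : ℤ) (m : ℕ) :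
    eVariationOn f (Set.Icc (z:ℝ) (z + m)) ≤ 2 * m := by
  have hper : ∀ z : ℤ, eVariationOn f (Set.Icc (z:ℝ) (z + 1)) ≤ 2 := by
    intro z
    refine le_trans ?_ hV
    have e : f ∘ (fun x => x - (z:ℝ)) = f := by
      ext x
      have := (show Function.Periodic f 1 from hp).sub_zsmul_eq z (x := x)
      simpa using this
    conv_lhs => rw [← e]
    apply eVariationOn.comp_le_of_monotoneOn
    · intro x _ y _ hxy
      simpa using hxy
    · intro x hx
      constructor <;> linarith [hx.1, hx.2]
  induction m with
  | zero => simp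
  | succ m ih =>
    have := eVariationOn.Icc_add_Icc f (s := Set.univ) (a := (z:ℝ)) (b := z + m)
      (c := z + (m + 1 : ℕ)) (by simp) (by simp) (Set.mem_univ _)
    simp only [Set.univ_inter] at this
    rw [← this]
    have h2 := hper (z + m)
    push_cast at h2 ⊢
    rw [mul_add, mul_one, ← add_assoc]
    exact add_le_add ih h2

lemma bv_decomp (f : ℝ → ℝ) (hp : ∀ x, f (x + 1) = f x)
    (hV : eVariationOn f (Set.Icc (0:ℝ) 1) ≤ 2) :
    ∃ p q : ℝ → ℝ, Monotone p ∧ Monotone q ∧ f = p - q ∧ (p 3 - p 0) + (q 3 - q 0) ≤ 6 := by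
  have hL : LocallyBoundedVariationOn f Set.univ := by
    intro a b _ _
    rw [Set.univ_inter]
    obtain ⟨m, hm⟩ := exists_nat_ge (b - ⌊a⌋)
    have h1 := var_int f hp hV ⌊a⌋ m
    have h2 : Set.Icc a b ⊆ Set.Icc (⌊a⌋ : ℝ) (⌊a⌋ + m) :=
      Set.Icc_subset_Icc (Int.floor_le a) (by linarith)
    refine ne_top_of_le_ne_top ?_ ((eVariationOn.mono f h2).trans h1)
    exact ENNReal.mul_ne_top (by simp) (by simp)
  obtain ⟨p, q, hpm, hqm, e, hv⟩ := hL.exists_monotoneOn_sub_monotoneOn'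
  refine ⟨p, q, monotoneOn_univ.1 hpm, monotoneOn_univ.1 hqm, e, ?_⟩
  rw [hv 0 (Set.mem_univ _) 3 (Set.mem_univ _), variationOnFromTo.eq_of_le _ _ (by norm_num),
    Set.univ_inter]
  have h1 := var_int f hp hV 0 3
  norm_num at h1
  have := ENNReal.toReal_mono (by norm_num) h1
  simpa using this

lemma approx (f : ℝ → ℝ) (hp : ∀ x, f (x + 1) = f x) (h0 : (∫ x in (0:ℝ)..1, f x) = 0)
    (hV : eVariationOn f (Set.Icc (0:ℝ) 1) ≤ 2) :
    ∃ (M : ℝ) (g g' : ℕ → ℝ → ℝ) (D : Set ℝ), D.Countable ∧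
      (∀ k x, HasDerivAt (g k) (g' k x) x) ∧ (∀ k, Continuous (g' k)) ∧
      (∀ k x, g k (x + 1) = g k x) ∧ (∀ k x, g' k (x + 1) = g' k x) ∧
      (∀ k, (∫ x in (0:ℝ)..1, g k x) = 0) ∧ (∀ k, (∫ x in (0:ℝ)..1, |g' k x|) ≤ 6) ∧
      (∀ k x, |g k x| ≤ M) ∧
      ∀ x, x ∉ D → Tendsto (fun k => g k x) atTop (nhds (f x)) := by
  obtain ⟨p, q, hpm, hqm, e, hpq⟩ := bv_decomp f hp hV
  have hpi : ∀ a b, IntervalIntegrable p volume a b := fun a b => hpm.intervalIntegrable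
  have hqi : ∀ a b, IntervalIntegrable q volume a b := fun a b => hqm.intervalIntegrable
  have hfi : ∀ a b, IntervalIntegrable f volume a b := fun a b => by
    rw [e]; exact (hpi a b).sub (hqi a b)
  have hM : ∀ x, |f x| ≤ |f 0| + 2 := by
    intro x
    obtain ⟨y, hy, hxy⟩ := (show Function.Periodic f 1 from hp).exists_mem_Ico₀ one_pos x
    rw [hxy]
    have h1 := (eVariationOn.edist_le f (s := Set.Icc (0:ℝ) 1) (x := y) (y := 0)
      ⟨hy.1, hy.2.le⟩ (by simp)).trans hV
    rw [edist_dist, Real.dist_eq] at h1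
    have h2 : |f y - f 0| ≤ 2 := by
      rw [ENNReal.ofReal_le_iff_le_toReal (by simp)] at h1
      simpa using h1
    have h3 := abs_add_le (f y - f 0) (f 0)
    rw [sub_add_cancel] at h3
    linarith
  set h : ℕ → ℝ := fun k => 1 / ((k:ℝ) + 1) with hh
  have hpos : ∀ k, 0 < h k := fun k => by simp only [hh]; positivity
  have hle : ∀ k, h k ≤ 1 := fun k => by
    simp only [hh]
    rw [div_le_one (by positivity)]
    have : (0:ℝ) ≤ k := Nat.cast_nonneg k
    linarith
  have hlim : Tendsto h atTop (nhds 0) := tendsto_one_div_add_atTop_nhds_zero_nat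
  have hc1 : ∀ k, Continuous (stek (h k) f) := fun k => stek_cont _ f hfi
  have hi1 : ∀ k a b, IntervalIntegrable (stek (h k) f) volume a b :=
    fun k a b => (hc1 k).intervalIntegrable a b
  refine ⟨|f 0| + 2, fun k => stek (h k) (stek (h k) f),
    fun k x => (stek (h k) f (x + h k) - stek (h k) f x) / h k,
    {x | ¬ ContinuousAt p x} ∪ {x | ¬ ContinuousAt q x},
    hpm.countable_not_continuousAt.union hqm.countable_not_continuousAt, ?_, ?_, ?_, ?_, ?_, ?_,
    ?_, ?_⟩
  · intro k x
    exact stek_deriv _ _ (hc1 k) x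
  · intro k
    have := hc1 k
    fun_prop
  · intro k x
    exact stek_per _ _ (stek_per _ _ hp) x
  · intro k x
    simp only
    rw [show x + 1 + h k = (x + h k) + 1 by ring, stek_per _ _ hp, stek_per _ _ hp]
  · intro k
    exact stek_mean _ _ (hi1 k) (stek_per _ _ hp) (stek_mean _ _ hfi hp h0)
  · intro k
    have cp := stek_cont (h k) p hpi
    have cq := stek_cont (h k) q hqi
    have cf := hc1 k
    have mp := stek_mono (h k) (hpos k) p hpm
    have mq := stek_mono (h k) (hpos k) q hqm
    have b1 := stek_incr (h k) (hpos k) (hle k) p hpm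
    have b2 := stek_incr (h k) (hpos k) (hle k) q hqm
    calc _ ≤ ∫ x in (0:ℝ)..1, ((stek (h k) p (x + h k) - stek (h k) p x) / h k +
          (stek (h k) q (x + h k) - stek (h k) q x) / h k) := by
          apply intervalIntegral.integral_mono_on zero_le_one
            (Continuous.intervalIntegrable (by fun_prop) _ _)
            (Continuous.intervalIntegrable (by fun_prop) _ _)
          intro x _
          have hk := hpos k
          have m1 : stek (h k) p x ≤ stek (h k) p (x + h k) := mp (by linarith)
          have m2 : stek (h k) q x ≤ stek (h k) q (x + h k) := mq (by linarith)
          beta_reduce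
          rw [e, stek_sub _ p q hpi hqi, stek_sub _ p q hpi hqi, abs_div, abs_of_pos hk, ← add_div]
          apply div_le_div_of_nonneg_right _ hk.le
          rw [abs_le]
          constructor <;> linarith
      _ = _ := intervalIntegral.integral_add (Continuous.intervalIntegrable (by fun_prop) _ _)
            (Continuous.intervalIntegrable (by fun_prop) _ _)
      _ ≤ 6 := by linarith
  · intro k x
    rw [abs_le]
    constructor
    · apply le_stek _ (hpos k) _ (hi1 k)
      intro t _
      apply le_stek _ (hpos k) _ hfi
      intro u _
      exact (abs_le.1 (hM u)).1
    · apply stek_le _ (hpos k) _ (hi1 k)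
      intro t _
      apply stek_le _ (hpos k) _ hfi
      intro u _
      exact (abs_le.1 (hM u)).2
  · intro x hx
    simp only [Set.mem_union, Set.mem_ofPred_eq, not_or, not_not] at hx
    have hcx : ContinuousAt f x := by rw [e]; exact hx.1.sub hx.2
    rw [Metric.tendsto_atTop]
    intro ε hε
    obtain ⟨δ, hδ, hfd⟩ := Metric.continuousAt_iff.1 hcx (ε / 2) (by linarith)
    obtain ⟨K, hK⟩ := Metric.tendsto_atTop.1 hlim (δ / 2) (by linarith)
    refine ⟨K, fun k hk => ?_⟩
    have hkk := hK k hk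
    rw [Real.dist_eq, sub_zero, abs_of_pos (hpos k)] at hkk
    have hnear : ∀ t ∈ Set.Icc x (x + h k), ∀ u ∈ Set.Icc t (t + h k),
        f x - ε / 2 ≤ f u ∧ f u ≤ f x + ε / 2 := by
      intro t ht u hu
      have : dist u x < δ := by
        rw [Real.dist_eq, abs_lt]
        constructor <;> linarith [ht.1, ht.2, hu.1, hu.2]
      have := hfd this
      rw [Real.dist_eq, abs_lt] at this
      constructor <;> linarith [this.1, this.2]
    rw [Real.dist_eq]
    refine lt_of_le_of_lt (b := ε / 2) ?_ (by linarith)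
    rw [abs_le]
    constructor
    · have : f x - ε / 2 ≤ stek (h k) (stek (h k) f) x := by
        apply le_stek _ (hpos k) _ (hi1 k)
        intro t ht
        apply le_stek _ (hpos k) _ hfi
        intro u hu
        exact (hnear t ht u hu).1
      linarith
    · have : stek (h k) (stek (h k) f) x ≤ f x + ε / 2 := by
        apply stek_le _ (hpos k) _ (hi1 k)
        intro t ht
        apply stek_le _ (hpos k) _ hfi
        intro u hu
        exact (hnear t ht u hu).2
      linarith

lemma coef_tendsto (f : ℝ → ℝ) (g : ℕ → ℝ → ℝ) (M : ℝ) (D : Set ℝ) (hD : D.Countable)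
    (hg : ∀ k, Continuous (g k)) (hM : ∀ k x, |g k x| ≤ M)
    (hlim : ∀ x, x ∉ D → Tendsto (fun k => g k x) atTop (nhds (f x)))
    (c : ℝ → ℝ) (hc : Continuous c) (hc1 : ∀ x, |c x| ≤ 1) :
    Tendsto (fun k => 2 * ∫ x in (0:ℝ)..1, g k x * c x) atTop
      (nhds (2 * ∫ x in (0:ℝ)..1, f x * c x)) := by
  apply Tendsto.const_mul
  apply intervalIntegral.tendsto_integral_filter_of_dominated_convergence (fun _ => M)
  · refine Eventually.of_forall fun k => ?_
    exact ((hg k).mul hc).aestronglyMeasurable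
  · refine Eventually.of_forall fun k => Eventually.of_forall fun x _ => ?_
    rw [Real.norm_eq_abs, abs_mul]
    calc _ ≤ M * 1 := mul_le_mul (hM k x) (hc1 x) (abs_nonneg _)
          ((abs_nonneg _).trans (hM k x))
      _ = M := mul_one M
  · simp
  · filter_upwards [hD.ae_notMem volume] with x hx _
    exact (hlim x hx).mul_const _

lemma coef_bound (g : ℝ → ℝ) (M : ℝ) (hM : ∀ x, |g x| ≤ M)
    (c : ℝ → ℝ) (hc1 : ∀ x, |c x| ≤ 1) : |2 * ∫ x in (0:ℝ)..1, g x * c x| ≤ 2 * M := by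
  rw [abs_mul, abs_two]
  have := intervalIntegral.norm_integral_le_of_norm_le_const (a := 0) (b := 1) (C := M)
    (f := fun x => g x * c x) fun x _ => by
    rw [Real.norm_eq_abs, abs_mul]
    calc _ ≤ M * 1 := mul_le_mul (hM x) (hc1 x) (abs_nonneg _) ((abs_nonneg _).trans (hM x))
      _ = M := mul_one M
  simp at this
  linarith

lemma fp_bound (g : ℝ → ℝ) (M : ℝ) (hM : ∀ x, |g x| ≤ M) (J : ℕ) (x : ℝ) :
    |fourierPartial g J x| ≤ J * (4 * M) := by
  unfold fourierPartial
  refine (Finset.abs_sum_le_sum_abs _ _).trans ?_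
  have hM0 : 0 ≤ M := (abs_nonneg _).trans (hM 0)
  calc _ ≤ ∑ j ∈ Finset.Icc 1 J, 4 * M := by
        apply Finset.sum_le_sum
        intro j _
        have h1 : |fourierA g j| ≤ 2 * M := coef_bound g M hM _ fun x => Real.abs_cos_le_one _
        have h2 : |fourierB g j| ≤ 2 * M := coef_bound g M hM _ fun x => Real.abs_sin_le_one _
        refine (abs_add_le _ _).trans ?_
        rw [abs_mul, abs_mul]
        have h3 := mul_le_mul h1 (Real.abs_cos_le_one (2 * Real.pi * j * x)) (abs_nonneg _)
          (by linarith)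
        have h4 := mul_le_mul h2 (Real.abs_sin_le_one (2 * Real.pi * j * x)) (abs_nonneg _)
          (by linarith)
        linarith
    _ = _ := by simp

theorem stmt19 (ξ A B : ℝ) (hξ : 0 < ξ) (hA : 1 < A) (hAB : B - A = 1) :
    ∃ C : ℝ, 0 < C ∧
      ∀ s : ℕ → ℕ, StrictMono s → (∀ n, 1 ≤ n → 1 ≤ s n) →
      ∀ f : ℝ → ℝ, (∀ x : ℝ, f (x + 1) = f x) → (∫ x in (0:ℝ)..1, f x) = 0 →
        eVariationOn f (Set.Icc (0:ℝ) 1) ≤ 2 →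
      ∀ J N : ℕ, 1 ≤ J → 1 ≤ N →
        (∫ x in A..B,
            (∑ n ∈ Finset.Icc 1 N,
              (f (ξ * x ^ s n) - fourierPartial f J (ξ * x ^ s n))) ^ 2) ≤
          C * N / J := by
  refine ⟨((A - 1) / 2)⁻¹ * (bigC ξ ((1 + A) / 2) (B + 1) *
        (2 * (1 - ((1 + A) / 2)⁻¹)⁻¹)), ?_, ?_⟩
  · have h1 : 0 < (A - 1) / 2 := by linarith
    have h2 : 0 < B + 1 - (1 + A) / 2 := by linarith
    have h3 : 0 < bigC ξ ((1 + A) / 2) (B + 1) := by unfold bigC; positivity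
    have h4 : 0 < 1 - ((1 + A) / 2)⁻¹ := by
      have := inv_lt_one_of_one_lt₀ (show 1 < (1 + A) / 2 by linarith)
      linarith
    positivity
  · intro s hs hs1 f hp h0 hV J N hJ _
    obtain ⟨M, g, g', D, hD, hd, hc, gp, gp', g0, gV, gM, glim⟩ := approx f hp h0 hV
    have hgc : ∀ k, Continuous (g k) := fun k =>
      continuous_iff_continuousAt.2 fun x => (hd k x).continuousAt
    have hbd := fun k => smooth_case ξ A B hξ hA hAB s hs hs1 (g k) (g' k) (hd k) (hc k) (gp k)
      (gp' k) (g0 k) (gV k) J N hJ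
    refine le_of_tendsto' (x := atTop) ?_ hbd
    have hfp : ∀ x, Tendsto (fun k => fourierPartial (g k) J x) atTop
        (nhds (fourierPartial f J x)) := by
      intro x
      unfold fourierPartial
      apply tendsto_finsetSum
      intro j _
      refine Tendsto.add (Tendsto.mul_const _ ?_) (Tendsto.mul_const _ ?_)
      · exact coef_tendsto f g M D hD hgc gM glim _ (by fun_prop) fun x => Real.abs_cos_le_one _
      · exact coef_tendsto f g M D hD hgc gM glim _ (by fun_prop) fun x => Real.abs_sin_le_one _
    apply intervalIntegral.tendsto_integral_filter_of_dominated_convergence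
      (fun _ => (N * (M + J * (4 * M))) ^ 2)
    · refine Eventually.of_forall fun k => Continuous.aestronglyMeasurable ?_
      have h1 := hgc k
      have h2 := fp_continuous (g k) J
      fun_prop
    · refine Eventually.of_forall fun k => Eventually.of_forall fun x _ => ?_
      rw [Real.norm_eq_abs, abs_pow]
      apply pow_le_pow_left₀ (abs_nonneg _)
      refine (Finset.abs_sum_le_sum_abs _ _).trans ?_
      calc _ ≤ ∑ n ∈ Finset.Icc 1 N, (M + J * (4 * M)) := by
            apply Finset.sum_le_sum
            intro n _
            exact (abs_sub _ _).trans (add_le_add (gM k _) (fp_bound (g k) M (gM k) J _))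
        _ = _ := by simp; ring
    · simp
    · have hall : ∀ᵐ x : ℝ, ∀ n ∈ Finset.Icc 1 N, 0 < x → ξ * x ^ s n ∉ D := by
        rw [Filter.eventually_all_finset]
        intro n hn
        have hsn : s n ≠ 0 := by
          have := hs1 n (Finset.mem_Icc.1 hn).1
          omega
        have hcnt : (Set.Ioi (0:ℝ) ∩ (fun x : ℝ => ξ * x ^ s n) ⁻¹' D).Countable := by
          apply Set.MapsTo.countable_of_injOn (f := fun x : ℝ => ξ * x ^ s n) (t := D) _ _ hD
          · intro x hx
            exact hx.2
          · intro x hx y hy hxy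
            have h1 : x ^ s n = y ^ s n := mul_left_cancel₀ hξ.ne' hxy
            exact (pow_left_inj₀ (le_of_lt hx.1) (le_of_lt hy.1) hsn).1 h1
        filter_upwards [hcnt.ae_notMem volume] with x hx h0x hxD
        exact hx ⟨h0x, hxD⟩
      filter_upwards [hall] with x hx hxI
      have hx0 : 0 < x := by
        rw [Set.uIoc_of_le (by linarith)] at hxI
        linarith [hxI.1]
      apply Tendsto.pow
      apply tendsto_finsetSum
      intro n hn
      exact (glim _ (hx n hn hx0)).sub (hfp _)
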